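/- arXiv:1805.02086 — 5 statements merged into one kernel-verified Lean document; each statement's English description precedes it below -/
import Mathlib

section
/- Let n ≥ 1. The set of expelling automorphisms is comeagre in Aut_{ω₀}(ℂⁿ); equivalently, for a generic f ∈ Aut_{ω₀}(ℂⁿ), the set of points whose forward orbit is relatively compact has empty interior. -/
open Topology Filter Metric Set Function

noncomputable section

/-- ℂⁿ with the Euclidean norm. -/
abbrev En (n : ℕ) : Type := EuclideanSpace ℂ (Fin n)

/-- A holomorphic automorphism of ℂⁿ: a bijection that is holomorphic with holomorphic inverse. -/
def IsHoloAut {n : ℕ} (f : En n → En n) : Prop :=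
  Differentiable ℂ f ∧ ∃ g : En n → En n, Differentiable ℂ g ∧
    Function.LeftInverse g f ∧ Function.RightInverse g f

/-- Volume-preserving with respect to ω₀ = dz₁∧⋯∧dzₙ: det Df(z) = 1 for all z. -/
def IsVolPres {n : ℕ} (f : En n → En n) : Prop :=
  ∀ z : En n, (fderiv ℂ f z).det = 1

/-- Aut(ℂⁿ) as a subset of C(ℂⁿ, ℂⁿ) with the compact-open topology. -/
def AutCN (n : ℕ) : Set C(En n, En n) := {f | IsHoloAut ⇑f}

/-- Aut_{ω₀}(ℂⁿ) as a subset of C(ℂⁿ, ℂⁿ) with the compact-open topology. -/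
def AutOmega (n : ℕ) : Set C(En n, En n) := {f | IsHoloAut ⇑f ∧ IsVolPres ⇑f}

/-- A continuous self-map is chaotic if it has a dense forward orbit and its set of
periodic points is dense. -/
def Chaotic {α : Type*} [TopologicalSpace α] (f : α → α) : Prop :=
  (∃ x : α, Dense (Set.range fun k : ℕ => f^[k] x)) ∧
  Dense {x : α | ∃ k : ℕ, 0 < k ∧ f^[k] x = x}

/-- Expelling: the set of points with unbounded forward orbit is dense. -/
def Expelling {n : ℕ} (f : En n → En n) : Prop :=
  Dense {x : En n | ¬ Bornology.IsBounded (Set.range fun k : ℕ => f^[k] x)}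

/-- p is a hyperbolic fixed point of f: f(p) = p and no eigenvalue of Df(p) has modulus 1. -/
def HypFixedPt {n : ℕ} (f : En n → En n) (p : En n) : Prop :=
  f p = p ∧ ∀ μ : ℂ, Module.End.HasEigenvalue
    ((fderiv ℂ f p : En n →ₗ[ℂ] En n) : Module.End ℂ (En n)) μ → ‖μ‖ ≠ 1

/-- The stable manifold of a fixed point p of f: points whose forward orbit tends to p. -/
def StableSet {n : ℕ} (f : En n → En n) (p : En n) : Set (En n) :=
  {x : En n | Tendsto (fun k : ℕ => f^[k] x) atTop (𝓝 p)}


section helpers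
open Complex

theorem cauchyE {E G : Type*} [NormedAddCommGroup E] [NormedSpace ℂ E] [NormedAddCommGroup G]
    [NormedSpace ℂ G] {F : E → G} (hF : Differentiable ℂ F) {x : E} {r M : ℝ} (hr : 0 < r)
    (h : ∀ z ∈ closedBall x r, ‖F z‖ ≤ M) : ‖fderiv ℂ F x‖ ≤ 2 * M / r := by
  apply Complex.norm_fderiv_le_div_of_mapsTo_ball hF.differentiableOn _ hr
  intro z hz
  rw [mem_closedBall, dist_eq_norm]
  have h1 := h z (ball_subset_closedBall hz)
  have h2 := h x (mem_closedBall_self hr.le)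
  have := norm_sub_le (F z) (F x)
  linarith

theorem inv_bound (n : ℕ) (C : ℝ) : ∃ C' : ℝ, ∀ A B : En n →L[ℂ] En n, A.det = 1 → ‖A‖ ≤ C →
    A * B = 1 → ‖B‖ ≤ C' := by
  have hK : IsCompact ({A : En n →L[ℂ] En n | A.det = 1} ∩ closedBall 0 C) := by
    apply (isCompact_closedBall (0 : En n →L[ℂ] En n) C).inter_left
    exact isClosed_eq ContinuousLinearMap.continuous_det continuous_const
  have hu : ∀ A : En n →L[ℂ] En n, A.det = 1 → IsUnit A := by
    intro A hA
    rw [ContinuousLinearMap.isUnit_iff_bijective]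
    have : IsUnit (A : En n →ₗ[ℂ] En n) := by
      rw [LinearMap.isUnit_iff_isUnit_det]
      have : LinearMap.det (A : En n →ₗ[ℂ] En n) = 1 := hA
      rw [this]; exact isUnit_one
    exact (Module.End.isUnit_iff _).1 this
  have hc : ContinuousOn (Ring.inverse : (En n →L[ℂ] En n) → _)
      ({A : En n →L[ℂ] En n | A.det = 1} ∩ closedBall 0 C) := by
    intro A hA
    obtain ⟨u, rfl⟩ := hu A hA.1
    exact (NormedRing.inverse_continuousAt u).continuousWithinAt
  obtain ⟨C', hC'⟩ := hK.exists_bound_of_continuousOn hc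
  refine ⟨C', fun A B hA hAC hAB => ?_⟩
  have := hC' A ⟨hA, by simpa using hAC⟩
  have hB : Ring.inverse A = B := by
    obtain ⟨u, hu'⟩ := hu A hA
    rw [← hu'] at hAB ⊢
    rw [Ring.inverse_unit]
    exact (Units.inv_eq_of_mul_eq_one_right hAB)
  rwa [hB] at this

theorem det_diff (n : ℕ) : Differentiable ℂ (fun T : En n →L[ℂ] En n => (1 + T).det) := by
  have : (fun T : En n →L[ℂ] En n => (1 + T).det) = fun T =>
      ∑ σ : Equiv.Perm (Fin n), ((Equiv.Perm.sign σ : ℤ) : ℂ) * ∏ i, 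
        ((1 + T) (EuclideanSpace.basisFun (Fin n) ℂ i)) (σ i) := by
    ext T
    show LinearMap.det ((1 + T : En n →L[ℂ] En n) : En n →ₗ[ℂ] En n) = _
    rw [← LinearMap.det_toMatrix (EuclideanSpace.basisFun (Fin n) ℂ).toBasis, Matrix.det_apply']
    simp [LinearMap.toMatrix_apply]
  rw [this]
  have key : ∀ (i j : Fin n), Differentiable ℂ (fun T : En n →L[ℂ] En n => 
      ((1 + T) (EuclideanSpace.basisFun (Fin n) ℂ i)) j) := by
    intro i j
    have h1 : Differentiable ℂ (fun T : En n →L[ℂ] En n => 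
      ((1 + T) (EuclideanSpace.basisFun (Fin n) ℂ i))) := by fun_prop
    exact (EuclideanSpace.proj (𝕜 := ℂ) j).differentiable.comp h1
  fun_prop

theorem det_est (n : ℕ) : ∃ C : ℝ, 0 ≤ C ∧ ∀ T : En n →L[ℂ] En n, ‖T‖ < 1 → (1 + T).det = 1 →
    ‖LinearMap.trace ℂ (En n) T‖ ≤ C * ‖T‖ ^ 2 := by
  let tr : (En n →L[ℂ] En n) →L[ℂ] ℂ := LinearMap.toContinuousLinearMap
    ((LinearMap.trace ℂ (En n)) ∘ₗ (ContinuousLinearMap.coeLM ℂ))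
  have htr : ∀ T, tr T = LinearMap.trace ℂ (En n) T := fun T => rfl
  let φ : (En n →L[ℂ] En n) → ℂ := fun T => (1 + T).det - tr T
  have hφ : Differentiable ℂ φ := (det_diff n).sub tr.differentiable
  have hφ0 : φ 0 = 1 := by simp [φ, ContinuousLinearMap.det]
  have hd : HasFDerivAt φ (0 : (En n →L[ℂ] En n) →L[ℂ] ℂ) 0 := by
    have h1 := (hφ 0).hasFDerivAt
    convert h1
    ext M
    symm
    have h2 : HasDerivAt (fun s : ℂ => φ (s • M)) (fderiv ℂ φ 0 M) 0 := by
      have : HasDerivAt (fun s : ℂ => s • M) M 0 := by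
        simpa using (hasDerivAt_id (0 : ℂ)).smul_const M
      have h1' : HasFDerivAt φ (fderiv ℂ φ 0) ((0 : ℂ) • M) := by
        have e : (0 : ℂ) • M = 0 := zero_smul ℂ M
        exact e ▸ h1
      exact h1'.comp_hasDerivAt 0 this
    have h3 : (fun s : ℂ => φ (s • M)) = fun s => 1 + (Polynomial.eval s
        (Matrix.det (1 + (Polynomial.X : Polynomial ℂ) • (LinearMap.toMatrix (EuclideanSpace.basisFun (Fin n) ℂ).toBasis (EuclideanSpace.basisFun (Fin n) ℂ).toBasis (M : En n →ₗ[ℂ] En n)).map Polynomial.C)).divX.divX) * s ^ 2 := by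
      ext s
      have e1 : (1 + s • M).det = LinearMap.det ((1 + s • M : En n →L[ℂ] En n) : En n →ₗ[ℂ] En n) := rfl
      have e2 : LinearMap.toMatrix (EuclideanSpace.basisFun (Fin n) ℂ).toBasis (EuclideanSpace.basisFun (Fin n) ℂ).toBasis ((1 + s • M : En n →L[ℂ] En n) : En n →ₗ[ℂ] En n) = 1 + s • LinearMap.toMatrix (EuclideanSpace.basisFun (Fin n) ℂ).toBasis (EuclideanSpace.basisFun (Fin n) ℂ).toBasis (M : En n →ₗ[ℂ] En n) := by
        rw [← LinearMap.toMatrix_one (EuclideanSpace.basisFun (Fin n) ℂ).toBasis]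
        simp only [← map_smul, ← map_add]
        rfl
      simp only [φ]
      rw [e1, ← LinearMap.det_toMatrix (EuclideanSpace.basisFun (Fin n) ℂ).toBasis, e2, Matrix.det_one_add_smul, htr,
        LinearMap.trace_eq_matrix_trace ℂ (EuclideanSpace.basisFun (Fin n) ℂ).toBasis]
      have : (((s • M : En n →L[ℂ] En n)) : En n →ₗ[ℂ] En n) = s • (M : En n →ₗ[ℂ] En n) := rfl
      rw [this, map_smul, Matrix.trace_smul, smul_eq_mul]
      ring
    rw [h3] at h2
    have h4 : ∀ P : Polynomial ℂ, HasDerivAt (fun s : ℂ => 1 + P.eval s * s ^ 2) 0 0 := by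
      intro P
      have := ((P.hasDerivAt 0).mul (hasDerivAt_pow 2 (0 : ℂ))).const_add 1
      simpa using this
    exact h2.unique (h4 _)
  obtain ⟨C, hC⟩ := (isCompact_closedBall (0 : En n →L[ℂ] En n) 1).exists_bound_of_continuousOn
    hφ.continuous.continuousOn
  refine ⟨2 * C, ?_, fun T hT hdet => ?_⟩
  · have := (norm_nonneg _).trans (hC 0 (by simp)); linarith
  have := Complex.dist_le_mul_div_pow_of_mapsTo_ball_of_isLittleO (f := φ) (c := 0) (R₁ := 1) (R₂ := 2 * C) (n := 1) (z := T) hφ.differentiableOn ?_ ?_ (by simpa using hT)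
  · rw [hφ0] at this
    simp only [φ, hdet, dist_eq_norm, htr] at this
    simpa using this
  · intro z hz
    rw [mem_closedBall, dist_eq_norm]
    have h1 := hC z (ball_subset_closedBall hz)
    have h2 := hC 0 (by simp)
    have := norm_sub_le (φ z) (φ 0)
    linarith
  · have := hd.isLittleO.norm_right
    simpa using this

end helpers


theorem three_circles {n : ℕ} (N δ R : ℝ) (hδ : 0 < δ) (hR : 0 < R) (x0 : En n) :
    ∃ η > 0, ∀ F : En n → En n, Differentiable ℂ F → (∀ z ∈ closedBall x0 (8 * R), ‖F z‖ ≤ N) →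
      (∀ z ∈ closedBall x0 (R / 2), ‖F z‖ ≤ η) → ∀ z ∈ closedBall x0 (3 * R), ‖F z‖ ≤ δ := by
  set N' := max N 1 with hN'
  have hN1 : 1 ≤ N' := le_max_right _ _
  have hN0 : 0 < N' := by linarith
  refine ⟨min (min 1 δ) ((δ / N') ^ 4), by positivity, ?_⟩
  set η := min (min 1 δ) ((δ / N') ^ 4) with hη
  have hη0 : 0 < η := by positivity
  intro F hF h8 h1 z hz
  set d := ‖z - x0‖ with hd
  have hd3 : d ≤ 3 * R := by simpa [dist_eq_norm] using hz
  rcases le_or_gt d (R / 2) with hle | hgt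
  · refine (h1 z (by simpa [dist_eq_norm] using hle)).trans ?_
    exact (min_le_left _ _).trans (min_le_right _ _)
  have hd0 : 0 < d := by linarith
  let l := Real.log (R / 2 / d)
  let u := Real.log (8 * R / d)
  have hlu : l < u := by
    apply Real.log_lt_log (by positivity)
    gcongr; linarith
  have hl0 : l ≤ 0 := by
    apply Real.log_nonpos (by positivity)
    rw [div_le_one hd0]; exact hgt.le
  have hu0 : 0 ≤ u := by
    apply Real.log_nonneg
    rw [le_div_iff₀ hd0]; linarith
  let G : ℂ → En n := fun s => F (x0 + Complex.exp s • (z - x0))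
  have hG : Differentiable ℂ G := by
    apply hF.comp
    apply Differentiable.const_add
    exact Complex.differentiable_exp.smul_const _
  have hnorm : ∀ s : ℂ, ‖(x0 + Complex.exp s • (z - x0)) - x0‖ = Real.exp s.re * d := by
    intro s
    rw [add_sub_cancel_left, norm_smul, Complex.norm_exp]
  have hb : ∀ s : ℂ, s.re ≤ u → ‖G s‖ ≤ N' := by
    intro s hs
    refine (h8 _ ?_).trans (le_max_left _ _)
    rw [mem_closedBall, dist_eq_norm, hnorm]
    calc Real.exp s.re * d ≤ Real.exp u * d := by gcongr
      _ = 8 * R := by rw [Real.exp_log (by positivity)]; field_simp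
  have ha : ∀ s ∈ Complex.re ⁻¹' {l}, ‖G s‖ ≤ η := by
    intro s hs
    apply h1
    rw [mem_closedBall, dist_eq_norm, hnorm]
    have : s.re = l := hs
    rw [this, Real.exp_log (by positivity)]
    apply le_of_eq; field_simp
  have key := Complex.HadamardThreeLines.norm_le_interp_of_mem_verticalClosedStrip' (f := G) (z := 0)
    (a := η) (b := N') hlu (by simp [Complex.HadamardThreeLines.verticalClosedStrip, hl0, hu0]) hG.diffContOnCl
    ⟨N', by rintro _ ⟨s, hs, rfl⟩; exact hb s hs.2⟩ ha (fun s hs => hb s (le_of_eq hs))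
  have hGz : G 0 = F z := by simp [G]
  rw [hGz] at key
  simp only [Complex.zero_re, zero_sub] at key
  set θ := -l / (u - l) with hθ
  have hθ0 : 0 ≤ θ := div_nonneg (by linarith) (by linarith)
  have hul : u - l = 4 * Real.log 2 := by
    simp only [u, l]
    rw [← Real.log_div (by positivity) (by positivity)]
    have : 8 * R / d / (R / 2 / d) = 2 ^ 4 := by field_simp; norm_num
    rw [this, Real.log_pow]; norm_num
  have hθ1 : θ ≤ 3 / 4 := by
    rw [hθ, div_le_iff₀ (by linarith), hul]
    have : -l ≤ Real.log (2 ^ 3) := by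
      simp only [l]
      rw [← Real.log_inv]
      apply Real.log_le_log (by positivity)
      rw [inv_div, div_div_eq_mul_div, div_le_iff₀ hR]; linarith
    rw [Real.log_pow] at this
    push_cast at this
    linarith
  have hη1 : η ≤ 1 := (min_le_left _ _).trans (min_le_left _ _)
  calc ‖F z‖ ≤ η ^ (1 - θ) * N' ^ θ := key
    _ ≤ η ^ (1 / 4 : ℝ) * N' ^ (1 : ℝ) := by
      gcongr ?_ * ?_
      · exact Real.rpow_le_rpow_of_exponent_ge hη0 hη1 (by linarith)
      · exact Real.rpow_le_rpow_of_exponent_le hN1 (by linarith)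
    _ ≤ ((δ / N') ^ 4) ^ (1 / 4 : ℝ) * N' := by
      rw [Real.rpow_one]
      gcongr
      exact min_le_right _ _
    _ = δ := by
      rw [← Real.rpow_natCast, ← Real.rpow_mul (by positivity)]
      norm_num
      field_simp


section density

theorem closed_integral_mem {E : Type*} [NormedAddCommGroup E] [NormedSpace ℂ E] [CompleteSpace E]
    (S : Submodule ℂ E) (hS : IsClosed (S : Set E)) (f : ℝ → E) (hf : Continuous f) (hm : ∀ t, f t ∈ S)
    (a b : ℝ) : (∫ t in a..b, f t) ∈ S := by
  have : CompleteSpace S := hS.completeSpace_coe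
  let f' : ℝ → S := fun t => ⟨f t, hm t⟩
  have hf' : Continuous f' := hf.subtype_mk _
  have := S.subtypeL.intervalIntegral_comp_comm (hf'.intervalIntegrable (μ := MeasureTheory.volume) a b)
  have h2 : (∫ t in a..b, f t) = S.subtypeL (∫ t in a..b, f' t) := by
    rw [← this]; rfl
  rw [h2]
  exact (∫ t in a..b, f' t).2

variable {n : ℕ}

def exC (P : Set (En n)) (l : En n →L[ℂ] ℂ) : C(P, ℂ) := ⟨fun z => Complex.exp (l z), by fun_prop⟩

def linC (P : Set (En n)) (l : En n →L[ℂ] ℂ) : C(P, ℂ) := ⟨fun z => l z, by fun_prop⟩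

def expAlg (P : Set (En n)) [CompactSpace P] : Subalgebra ℂ C(P, ℂ) :=
  (Algebra.adjoin ℂ (Set.range (exC P))).topologicalClosure

theorem expAlg_closed (P : Set (En n)) [CompactSpace P] : IsClosed (expAlg P : Set C(P, ℂ)) :=
  Subalgebra.isClosed_topologicalClosure _

theorem adjoin_exp_span (P : Set (En n)) [CompactSpace P] (a : C(P, ℂ))
    (ha : a ∈ Algebra.adjoin ℂ (Set.range (exC P))) : a ∈ Submodule.span ℂ (Set.range (exC P)) := by
  rw [← Subalgebra.mem_toSubmodule, Algebra.adjoin_eq_span] at ha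
  let M : Submonoid C(P, ℂ) :=
    { carrier := Set.range (exC P)
      mul_mem' := by
        rintro _ _ ⟨l, rfl⟩ ⟨m, rfl⟩
        refine ⟨l + m, ?_⟩
        ext z
        simp [exC, Complex.exp_add]
      one_mem' := ⟨0, by ext z; simp [exC]⟩ }
  have : Submonoid.closure (Set.range (exC P)) = M := Submonoid.closure_eq M
  rw [this] at ha
  exact ha

theorem lin_mem (R : ℝ) (l : En n →L[ℂ] ℂ) :
    linC (closedBall (0 : En n) R) l ∈ expAlg (closedBall (0 : En n) R) := by
  rw [← SetLike.mem_coe, expAlg, Subalgebra.topologicalClosure_coe, Metric.mem_closure_iff]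
  intro ε hε
  set M := ‖l‖ * |R| + 1 with hM
  have hM0 : 0 < M := by positivity
  set t : ℝ := min (1 / M) (ε / (2 * M ^ 2)) with ht
  have ht0 : 0 < t := by positivity
  have htM : t * M ≤ 1 := by
    calc t * M ≤ 1 / M * M := by gcongr; exact min_le_left _ _
      _ = 1 := by field_simp
  refine ⟨(t : ℂ)⁻¹ • (exC _ ((t : ℂ) • l) - 1), ?_, ?_⟩
  · refine Subalgebra.smul_mem _ (Subalgebra.sub_mem _ (Algebra.subset_adjoin (Set.mem_range_self _)) (Subalgebra.one_mem _)) _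
  · rw [dist_comm, dist_eq_norm]
    refine lt_of_le_of_lt ((ContinuousMap.norm_le _ (C := ε / 2) (by positivity)).2 ?_) (by linarith)
    intro z
    have hz : ‖l z‖ ≤ M := by
      have h1 := l.le_opNorm z
      have h2 : ‖(z : En n)‖ ≤ R := mem_closedBall_zero_iff.1 z.2
      have h3 : ‖l‖ * ‖(z : En n)‖ ≤ ‖l‖ * |R| := by gcongr; exact h2.trans (le_abs_self R)
      linarith
    have hu : ‖(t : ℂ) * l z‖ ≤ t * M := by
      rw [norm_mul, Complex.norm_real, Real.norm_of_nonneg ht0.le]; gcongr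
    have h4 := Complex.norm_exp_sub_one_sub_id_le (hu.trans htM)
    have h5 : (((t : ℂ)⁻¹ • (exC (closedBall (0 : En n) R) ((t : ℂ) • l) - 1) - linC (closedBall (0 : En n) R) l : C(closedBall (0 : En n) R, ℂ)) z) = (t : ℂ)⁻¹ * (Complex.exp ((t : ℂ) * l z) - 1 - (t : ℂ) * l z) := by
      have : (t : ℂ) ≠ 0 := by exact_mod_cast ht0.ne'
      simp [exC, linC]
      field_simp
    rw [h5, norm_mul, norm_inv, Complex.norm_real, Real.norm_of_nonneg ht0.le]
    calc t⁻¹ * ‖Complex.exp ((t : ℂ) * l z) - 1 - (t : ℂ) * l z‖ ≤ t⁻¹ * (t * M) ^ 2 := by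
          gcongr; exact h4.trans (by gcongr)
      _ = t * M ^ 2 := by field_simp
      _ ≤ ε / (2 * M ^ 2) * M ^ 2 := by gcongr; exact min_le_right _ _
      _ = ε / 2 := by field_simp

theorem resolvent_mem (R : ℝ) (i : Fin n) (ζ : ℂ) (hζ : |R| < ‖ζ‖) (r : C(closedBall (0 : En n) R, ℂ))
    (hr : ∀ z, r z = (ζ - (z : En n) i)⁻¹) : r ∈ expAlg (closedBall (0 : En n) R) := by
  let a : C(closedBall (0 : En n) R, ℂ) := ζ⁻¹ • linC _ (EuclideanSpace.proj (𝕜 := ℂ) i : En n →L[ℂ] ℂ)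
  have hζ0 : ζ ≠ 0 := by
    rintro rfl
    simp at hζ
    exact absurd hζ (abs_nonneg R).not_gt
  have ha : a ∈ expAlg (closedBall (0 : En n) R) := Subalgebra.smul_mem _ (lin_mem R _) _
  have hap : ∀ z, a z = ζ⁻¹ * (z : En n) i := fun z => rfl
  have hζ' : 0 < ‖ζ‖ := norm_pos_iff.2 hζ0
  have hna : ‖a‖ < 1 := by
    refine lt_of_le_of_lt ((ContinuousMap.norm_le _ (C := ‖ζ‖⁻¹ * |R|) (by positivity)).2 ?_) ?_
    · intro z
      rw [hap, norm_mul, norm_inv]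
      gcongr
      have h2 : ‖(z : En n)‖ ≤ R := mem_closedBall_zero_iff.1 z.2
      exact (PiLp.norm_apply_le _ _).trans (h2.trans (le_abs_self R))
    · rw [inv_mul_lt_iff₀ hζ']; simpa using hζ
  have hS : (∑' k : ℕ, a ^ k) ∈ expAlg (closedBall (0 : En n) R) := by
    have := (summable_geometric_of_norm_lt_one hna).hasSum.tendsto_sum_nat
    refine (expAlg_closed _).mem_of_tendsto this (Eventually.of_forall fun k => ?_)
    exact Subalgebra.sum_mem _ fun j _ => Subalgebra.pow_mem _ ha _
  have : r = ζ⁻¹ • ∑' k : ℕ, a ^ k := by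
    ext z
    have h1 := congrArg (fun b : C(closedBall (0 : En n) R, ℂ) => b z) (mul_neg_geom_series a hna)
    simp only [ContinuousMap.mul_apply, ContinuousMap.sub_apply, ContinuousMap.one_apply, hap] at h1
    rw [hr, ContinuousMap.smul_apply, smul_eq_mul]
    generalize (∑' k : ℕ, a ^ k) z = S at h1
    have h2 : (ζ - (z : En n) i) * (ζ⁻¹ * S) = 1 := by
      rw [← h1]; field_simp
    exact (eq_inv_of_mul_eq_one_right h2).symm
  rw [this]
  exact Subalgebra.smul_mem _ hS _

def mixv (s : Finset (Fin n)) (z w : En n) : En n := WithLp.toLp 2 (fun i => if i ∈ s then z i else w i)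

theorem mixv_cont (s : Finset (Fin n)) : Continuous (fun p : En n × En n => mixv s p.1 p.2) := by
  unfold mixv
  apply (PiLp.continuous_toLp 2 _).comp
  apply continuous_pi
  intro i
  split_ifs <;> fun_prop

theorem mix_mem {h : En n → ℂ} (hh : Differentiable ℂ h) (R : ℝ) (s : Finset (Fin n)) :
    ∀ w : En n, (⟨fun z => h (mixv s z w), by
      exact hh.continuous.comp ((mixv_cont s).comp (by fun_prop : Continuous fun z : closedBall (0 : En n) R => ((z : En n), w)))⟩ : C(closedBall (0 : En n) R, ℂ)) ∈ expAlg (closedBall (0 : En n) R) := by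
  classical
  induction s using Finset.induction_on with
  | empty =>
    intro w
    have := Subalgebra.algebraMap_mem (expAlg (closedBall (0 : En n) R)) (h (mixv ∅ 0 w))
    convert this using 1
    ext z
    simp [mixv]
  | insert i s hi ih =>
    intro w
    set upd : ℂ → En n := fun ζ => WithLp.toLp 2 (Function.update (fun j => w j) i ζ) with hupd
    have hupdc : Continuous upd := by
      apply (PiLp.continuous_toLp 2 _).comp
      exact continuous_const.update i continuous_id
    have hupdd : ∀ z : En n, Differentiable ℂ (fun ζ => mixv s z (upd ζ)) := by
      intro z
      have : (fun ζ => mixv s z (upd ζ)) = fun ζ => mixv s z (upd 0) + ζ • EuclideanSpace.single i (1 : ℂ) := by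
        ext ζ j
        by_cases hj : j = i
        · subst hj; simp [mixv, upd, hi]
        · by_cases hjs : j ∈ s <;> simp [mixv, upd, hj, hjs]
      rw [this]
      fun_prop
    set R' : ℝ := |R| + 1 with hR'
    have hR'0 : 0 < R' := by positivity
    have hzi : ∀ z : closedBall (0 : En n) R, ‖(z : En n) i‖ < R' := by
      intro z
      have h2 : ‖(z : En n)‖ ≤ R := mem_closedBall_zero_iff.1 z.2
      have := (PiLp.norm_apply_le (z : En n) i).trans (h2.trans (le_abs_self R))
      linarith
    have hne : ∀ (θ : ℝ) (z : closedBall (0 : En n) R), circleMap 0 R' θ - (z : En n) i ≠ 0 := by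
      intro θ z h0
      have h1 : ‖circleMap 0 R' θ‖ = R' := by simp [abs_of_pos hR'0]
      rw [sub_eq_zero] at h0
      rw [h0] at h1
      exact (hzi z).ne h1
    let Ψ : C(ℝ, C(closedBall (0 : En n) R, ℂ)) := ContinuousMap.curry
      ⟨fun p => deriv (circleMap 0 R') p.1 • ((circleMap 0 R' p.1 - (p.2 : En n) i)⁻¹ • h (mixv s p.2 (upd (circleMap 0 R' p.1)))), by
        simp only [deriv_circleMap]
        have c0 : Continuous (fun p : ℝ × closedBall (0 : En n) R => circleMap 0 R' p.1) :=
          (continuous_circleMap 0 R').comp continuous_fst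
        have c1 : Continuous (fun p : ℝ × closedBall (0 : En n) R => (circleMap 0 R' p.1 - (p.2 : En n) i)⁻¹) :=
          (c0.sub (by fun_prop)).inv₀ (fun p => hne p.1 p.2)
        have c2 : Continuous (fun p : ℝ × closedBall (0 : En n) R => h (mixv s p.2 (upd (circleMap 0 R' p.1)))) :=
          hh.continuous.comp ((mixv_cont s).comp ((by fun_prop : Continuous fun p : ℝ × closedBall (0 : En n) R => (p.2 : En n)).prodMk (hupdc.comp c0)))
        exact (c0.mul continuous_const).smul (c1.smul c2)⟩
    have hΨ : ∀ θ z, Ψ θ z = deriv (circleMap 0 R') θ • ((circleMap 0 R' θ - (z : En n) i)⁻¹ • h (mixv s z (upd (circleMap 0 R' θ)))) := fun θ z => rfl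
    have hΨm : ∀ θ, Ψ θ ∈ expAlg (closedBall (0 : En n) R) := by
      intro θ
      let r : C(closedBall (0 : En n) R, ℂ) := ⟨fun z => (circleMap 0 R' θ - (z : En n) i)⁻¹, by
        exact (continuous_const.sub (by fun_prop)).inv₀ (fun p => hne θ p)⟩
      have hr := resolvent_mem R i (circleMap 0 R' θ) (by rw [norm_circleMap_zero, abs_of_pos hR'0]; linarith) r (fun z => rfl)
      have := Subalgebra.smul_mem _ (Subalgebra.mul_mem _ hr (ih (upd (circleMap 0 R' θ)))) (deriv (circleMap 0 R') θ)
      have e : Ψ θ = deriv (circleMap 0 R') θ • (r * (⟨fun z => h (mixv s z (upd (circleMap 0 R' θ))), by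
      exact hh.continuous.comp ((mixv_cont s).comp (by fun_prop : Continuous fun z : closedBall (0 : En n) R => ((z : En n), (upd (circleMap 0 R' θ)))))⟩ : C(closedBall (0 : En n) R, ℂ))) := by
        ext z
        rw [hΨ]
        rfl
      rw [e]
      exact this
    let S := Subalgebra.toSubmodule (expAlg (closedBall (0 : En n) R))
    have hScl : IsClosed (S : Set C(closedBall (0 : En n) R, ℂ)) := expAlg_closed _
    have hint : IntervalIntegrable Ψ MeasureTheory.volume 0 (2 * Real.pi) := Ψ.continuous.intervalIntegrable _ _
    have hI : (∫ θ in (0 : ℝ)..(2 * Real.pi), Ψ θ) ∈ S := by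
      exact closed_integral_mem S hScl Ψ Ψ.continuous hΨm _ _
    have hfin : (⟨fun z => h (mixv (insert i s) z w), by
      exact hh.continuous.comp ((mixv_cont _).comp (by fun_prop : Continuous fun z : closedBall (0 : En n) R => ((z : En n), w)))⟩ : C(closedBall (0 : En n) R, ℂ)) = (2 * Real.pi * Complex.I : ℂ)⁻¹ • (∫ θ in (0 : ℝ)..(2 * Real.pi), Ψ θ) := by
      ext z
      have h1 := (ContinuousMap.evalCLM ℂ z).intervalIntegral_comp_comm hint
      have h2 : ∀ b : C(closedBall (0 : En n) R, ℂ), ContinuousMap.evalCLM ℂ z b = b z := fun b => rfl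
      simp only [h2] at h1
      rw [ContinuousMap.smul_apply, ← h1]
      simp only [hΨ]
      have h3 := Complex.two_pi_I_inv_smul_circleIntegral_sub_inv_smul_of_differentiable_on_off_countable (c := 0) (R := R') (w := (z : En n) i) (f := fun ζ => h (mixv s z (upd ζ))) Set.countable_empty (by simpa using hzi z) ((hh.comp (hupdd z)).continuous.continuousOn) (fun x _ => (hh.comp (hupdd z)) x)
      have h4 : mixv s z (upd ((z : En n) i)) = mixv (insert i s) z w := by
        ext j
        by_cases hj : j = i
        · subst hj; simp [mixv, upd, hi]
        · by_cases hjs : j ∈ s <;> simp [mixv, upd, hj, hjs]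
      rw [h4] at h3
      exact h3.symm
    rw [hfin]
    exact Subalgebra.smul_mem _ hI _

theorem exp_dense {h : En n → ℂ} (hh : Differentiable ℂ h) (R ε : ℝ) (hε : 0 < ε) :
    ∃ c : (En n →L[ℂ] ℂ) →₀ ℂ, ∀ z ∈ closedBall (0 : En n) R,
      ‖h z - ∑ l ∈ c.support, c l * Complex.exp (l z)‖ ≤ ε := by
  have h1 := mix_mem hh R Finset.univ 0
  rw [← SetLike.mem_coe, expAlg, Subalgebra.topologicalClosure_coe, Metric.mem_closure_iff] at h1
  obtain ⟨b, hb, hd⟩ := h1 ε hε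
  obtain ⟨c, hc⟩ := Finsupp.mem_span_range_iff_exists_finsupp.1 (adjoin_exp_span _ b hb)
  refine ⟨c, fun z hz => ?_⟩
  rw [dist_eq_norm] at hd
  refine le_trans ?_ (((ContinuousMap.norm_coe_le_norm _ ⟨z, hz⟩)).trans hd.le)
  rw [← hc]
  apply le_of_eq
  congr 1
  simp [mixv, Finsupp.sum, exC, ContinuousMap.sum_apply]

end density


section dyn

variable {n : ℕ}

def Bk (f g : En n → En n) (j : ℕ) (x : En n) : En n →L[ℂ] En n := fderiv ℂ (g^[j]) (f^[j] x)

theorem B_mul {f g : En n → En n} (hf : Differentiable ℂ f) (hg : Differentiable ℂ g)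
    (hl : Function.LeftInverse g f) (j : ℕ) (x : En n) :
    Bk f g j x * fderiv ℂ (f^[j]) x = 1 := by
  have h1 := fderiv_comp x (hg.iterate j (f^[j] x)) (hf.iterate j x)
  have h2 : g^[j] ∘ f^[j] = id := (hl.iterate j).comp_eq_id
  rw [h2, fderiv_id] at h1
  exact h1.symm

theorem mul_B {f g : En n → En n} (hf : Differentiable ℂ f) (hg : Differentiable ℂ g)
    (hl : Function.LeftInverse g f) (hr : Function.RightInverse g f) (j : ℕ) (x : En n) :
    fderiv ℂ (f^[j]) x * Bk f g j x = 1 := by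
  have h1 := fderiv_comp (f^[j] x) (hf.iterate j (g^[j] (f^[j] x))) (hg.iterate j (f^[j] x))
  have h2 : f^[j] ∘ g^[j] = id := (hr.iterate j).comp_eq_id
  rw [h2, fderiv_id, (hl.iterate j) x] at h1
  exact h1.symm

theorem fderiv_iter_add {f : En n → En n} (hf : Differentiable ℂ f) (j k : ℕ) (x : En n) :
    fderiv ℂ (f^[j + k]) x = fderiv ℂ (f^[j]) (f^[k] x) * fderiv ℂ (f^[k]) x := by
  rw [Function.iterate_add]
  exact fderiv_comp x (hf.iterate j _) (hf.iterate k _)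

theorem det_mul' (A B : En n →L[ℂ] En n) : (A * B).det = A.det * B.det := by
  show LinearMap.det ((A : En n →ₗ[ℂ] En n) ∘ₗ (B : En n →ₗ[ℂ] En n)) = _
  exact LinearMap.det_comp _ _

theorem det_iter {f : En n → En n} (hf : Differentiable ℂ f) (hd : IsVolPres f) (k : ℕ) (x : En n) :
    (fderiv ℂ (f^[k]) x).det = 1 := by
  induction k with
  | zero => 
    simp only [Function.iterate_zero, fderiv_id]
    exact LinearMap.det_id
  | succ k ih =>
    rw [Nat.add_comm, fderiv_iter_add hf, det_mul', ih, mul_one, Function.iterate_one]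
    exact hd _

theorem det_one_add_rank_one (l : En n →L[ℂ] ℂ) (v : En n) (hlv : l v = 0) (c : ℂ) :
    (1 + c • l.smulRight v : En n →L[ℂ] En n).det = 1 := by
  have h1 : LinearMap.det (LinearMap.transvection (l : En n →ₗ[ℂ] ℂ) (c • v)) = 1 := by
    rw [LinearMap.transvection.det]
    simp [hlv]
  rw [← h1]
  show LinearMap.det _ = LinearMap.det _
  congr 1
  ext z
  simp [LinearMap.transvection]
  ring

def shear (l : En n →L[ℂ] ℂ) (v : En n) (h : ℂ → ℂ) (t : ℂ) (z : En n) : En n := z + (t * h (l z)) • v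

theorem shear_diff (l : En n →L[ℂ] ℂ) (v : En n) {h : ℂ → ℂ} (hh : Differentiable ℂ h) (t : ℂ) :
    Differentiable ℂ (shear l v h t) := by
  unfold shear
  have : Differentiable ℂ (fun z => h (l z)) := hh.comp l.differentiable
  fun_prop

theorem shear_inv (l : En n →L[ℂ] ℂ) (v : En n) (hlv : l v = 0) (h : ℂ → ℂ) (t : ℂ) (z : En n) :
    shear l v h (-t) (shear l v h t z) = z := by
  simp [shear, hlv]

theorem shear_vol (l : En n →L[ℂ] ℂ) (v : En n) (hlv : l v = 0) {h : ℂ → ℂ} (hh : Differentiable ℂ h) (t : ℂ) :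
    IsVolPres (shear l v h t) := by
  intro z
  have h1 : HasFDerivAt (shear l v h t) (1 + (t * deriv h (l z)) • l.smulRight v : En n →L[ℂ] En n) z := by
    have h2 : HasFDerivAt (fun z => h (l z)) (deriv h (l z) • (l : En n →L[ℂ] ℂ)) z :=
      (hh (l z)).hasDerivAt.comp_hasFDerivAt z l.hasFDerivAt
    have h3 := (hasFDerivAt_id z).add ((h2.const_mul t).smul_const v)
    convert! h3 using 1
    ext w : 1
    simp [smul_smul, mul_assoc]
  rw [h1.fderiv]
  exact det_one_add_rank_one l v hlv _

theorem bounded_sum (f : AutOmega n) (g : En n → En n) (hg : Differentiable ℂ g)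
    (hl : Function.LeftInverse g f.1) (hr : Function.RightInverse g f.1) (O : Set (AutOmega n)) (hO : IsOpen O)
    (hfO : f ∈ O) (U : Set (En n)) (N : ℝ) (hb : ∀ φ ∈ O, ∀ x ∈ U, ∀ k, ‖φ.1^[k] x‖ ≤ N)
    (l : En n →L[ℂ] ℂ) (v : En n) (hlv : l v = 0) (h : ℂ → ℂ) (hh : Differentiable ℂ h) :
    ∃ M, ∀ x ∈ U, ∀ k, ‖fderiv ℂ (f.1^[k]) x (∑ j ∈ Finset.range k,
      Bk f.1 g (j + 1) x (h (l (f.1^[j + 1] x)) • v))‖ ≤ M := by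
  have hf : Differentiable ℂ f.1 := f.2.1.1
  let G : ℂ → AutOmega n := fun t => ⟨⟨fun z => shear l v h t (f.1 z), ((shear_diff l v hh t).comp hf).continuous⟩, by
    refine ⟨⟨(shear_diff l v hh t).comp hf, fun z => g (shear l v h (-t) z), hg.comp (shear_diff l v hh (-t)), ?_, ?_⟩, ?_⟩
    · intro z
      show g (shear l v h (-t) (shear l v h t (f.1 z))) = z
      rw [shear_inv l v hlv, hl z]
    · intro z
      show shear l v h t (f.1 (g (shear l v h (-t) z))) = z
      rw [hr]
      have := shear_inv l v hlv h (-t) z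
      rwa [neg_neg] at this
    · intro z
      have := fderiv_comp z (shear_diff l v hh t (f.1 z)) (hf z)
      show (fderiv ℂ (shear l v h t ∘ f.1) z).det = 1
      rw [this]
      have h2 := det_mul' (fderiv ℂ (shear l v h t) (f.1 z)) (fderiv ℂ f.1 z)
      rw [shear_vol l v hlv hh t, f.2.2 z, mul_one] at h2
      exact h2⟩
  have hGap : ∀ t z, (G t).1 z = f.1 z + (t * h (l (f.1 z))) • v := fun t z => rfl
  have hGc : Continuous G := by
    refine Continuous.subtype_mk ?_ _
    let H : C(ℂ × En n, En n) := ⟨fun p => f.1 p.2 + (p.1 * h (l (f.1 p.2))) • v, by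
      have := hh.continuous
      have := f.1.continuous
      fun_prop⟩
    exact (ContinuousMap.curry H).continuous
  have hG0 : G 0 = f := by
    apply Subtype.ext
    ext z : 1
    rw [hGap]; simp
  have hnear : ∀ᶠ t in 𝓝 (0 : ℂ), G t ∈ O := by
    apply hGc.continuousAt.eventually_mem
    rw [hG0]
    exact hO.mem_nhds hfO
  obtain ⟨r, hr0, hrO⟩ := Metric.eventually_nhds_iff.1 hnear
  have hdiff : ∀ x k, Differentiable ℂ (fun t => (G t).1^[k] x) := by
    intro x k
    induction k with
    | zero => simp
    | succ k ih =>
      simp only [Function.iterate_succ_apply', hGap]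
      have h1 : Differentiable ℂ (fun t => f.1 ((G t).1^[k] x)) := hf.comp ih
      have h2 : Differentiable ℂ (fun t => h (l (f.1 ((G t).1^[k] x)))) := hh.comp (l.differentiable.comp h1)
      fun_prop
  have hder : ∀ x k, HasDerivAt (fun t => (G t).1^[k] x) (fderiv ℂ (f.1^[k]) x (∑ j ∈ Finset.range k,
      Bk f.1 g (j + 1) x (h (l (f.1^[j + 1] x)) • v))) 0 := by
    intro x k
    induction k with
    | zero => simp [hasDerivAt_const]
    | succ k ih =>
      have e0 : (G 0).1^[k] x = f.1^[k] x := by rw [hG0]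
      have h1 : HasDerivAt (fun t => f.1 ((G t).1^[k] x)) (fderiv ℂ f.1 (f.1^[k] x) (fderiv ℂ (f.1^[k]) x (∑ j ∈ Finset.range k,
      Bk f.1 g (j + 1) x (h (l (f.1^[j + 1] x)) • v)))) 0 := by
        have := (hf (f.1^[k] x)).hasFDerivAt
        rw [← e0] at this
        have h3 := this.comp_hasDerivAt 0 ih
        rw [e0] at h3
        exact h3
      have h2 : Differentiable ℂ (fun t => h (l (f.1 ((G t).1^[k] x)))) := hh.comp (l.differentiable.comp (hf.comp (hdiff x k)))
      have h3 := h1.add (((hasDerivAt_id (0 : ℂ)).mul (h2 0).hasDerivAt).smul_const v)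
      simp only [id, zero_mul, one_mul, add_zero, e0] at h3
      have e1 : (fun t => (G t).1^[k + 1] x) = (fun t => f.1 ((G t).1^[k] x)) + fun t => (t * h (l (f.1 ((G t).1^[k] x)))) • v := by
        ext1 t
        rw [Function.iterate_succ_apply', hGap]; rfl
      rw [e1]
      convert! h3 using 1
      rw [Finset.sum_range_succ, map_add]
      have e2 : fderiv ℂ (f.1^[k + 1]) x (Bk f.1 g (k + 1) x (h (l (f.1^[k + 1] x)) • v)) = h (l (f.1^[k + 1] x)) • v := by
        have := mul_B hf hg hl hr (k + 1) x
        exact congrArg (fun A : En n →L[ℂ] En n => A (h (l (f.1^[k + 1] x)) • v)) this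
      rw [e2]
      congr 1
      · have := fderiv_iter_add hf 1 k x
        rw [Nat.add_comm, this]; rfl
      · rw [Function.iterate_succ_apply']
  refine ⟨N / (r / 2), fun x hx k => ?_⟩
  rw [← (hder x k).deriv]
  apply Complex.norm_deriv_le_of_forall_mem_sphere_norm_le (by positivity) (hdiff x k).diffContOnCl
  intro t ht
  apply hb _ (hrO _) x hx k
  rw [mem_sphere] at ht
  linarith

end dyn


structure Dyn {n : ℕ} (f g : En n → En n) (x0 : En n) (R N C : ℝ) : Prop where
  hf : Differentiable ℂ f
  hg : Differentiable ℂ g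
  hl : Function.LeftInverse g f
  hr : Function.RightInverse g f
  hd : IsVolPres f
  hR : 0 < R
  hC : 1 ≤ C
  hN : ∀ x ∈ closedBall x0 (8 * R), ∀ k : ℕ, ‖f^[k] x‖ ≤ N
  hA : ∀ x ∈ closedBall x0 (6 * R), ∀ k : ℕ, ‖fderiv ℂ (f^[k]) x‖ ≤ C
  hB : ∀ x ∈ closedBall x0 (6 * R), ∀ k : ℕ, ‖Bk f g k x‖ ≤ C
  hL : ∀ x ∈ closedBall x0 (4 * R), ∀ y ∈ closedBall x0 (4 * R), ∀ k : ℕ,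
    ‖fderiv ℂ (f^[k]) y - fderiv ℂ (f^[k]) x‖ ≤ C * ‖y - x‖
  hQ : ∀ x ∈ closedBall x0 (4 * R), ∀ y ∈ closedBall x0 (4 * R), ∀ k : ℕ,
    ‖f^[k] y - f^[k] x - fderiv ℂ (f^[k]) x (y - x)‖ ≤ C * ‖y - x‖ ^ 2
  hS : ∀ (l : En n →L[ℂ] ℂ) (v : En n), l v = 0 → ∀ h : ℂ → ℂ, Differentiable ℂ h →
    ∃ M, ∀ x ∈ closedBall x0 (6 * R), ∀ k : ℕ, ‖∑ j ∈ Finset.range k,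
      Bk f g (j + 1) x (h (l (f^[j + 1] x)) • v)‖ ≤ M

theorem exists_dyn {n : ℕ} (f : AutOmega n) (O : Set (AutOmega n)) (hO : IsOpen O) (hfO : f ∈ O)
    (x0 : En n) (R N : ℝ) (hR : 0 < R)
    (hb : ∀ φ ∈ O, ∀ x ∈ closedBall x0 (8 * R), ∀ k, ‖φ.1^[k] x‖ ≤ N) :
    ∃ g C, Dyn f.1 g x0 R N C := by
  obtain ⟨⟨hf, g, hg, hl, hr⟩, hd⟩ := f.2
  have hN : ∀ x ∈ closedBall x0 (8 * R), ∀ k : ℕ, ‖f.1^[k] x‖ ≤ N := fun x hx k => hb f hfO x hx k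
  have hN0 : 0 ≤ N := (norm_nonneg _).trans (hN x0 (mem_closedBall_self (by positivity)) 0)
  set C1 := 2 * N / (2 * R) with hC1
  have hC10 : 0 ≤ C1 := by positivity
  have hA : ∀ x ∈ closedBall x0 (6 * R), ∀ k : ℕ, ‖fderiv ℂ (f.1^[k]) x‖ ≤ C1 := by
    intro x hx k
    apply cauchyE (hf.iterate k) (by positivity)
    intro z hz
    apply hN
    rw [mem_closedBall] at *
    have := dist_triangle z x x0
    linarith
  obtain ⟨C2, hC2⟩ := inv_bound n C1
  have hB : ∀ x ∈ closedBall x0 (6 * R), ∀ k : ℕ, ‖Bk f.1 g k x‖ ≤ C2 := by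
    intro x hx k
    exact hC2 _ _ (det_iter hf hd k x) (hA x hx k) (mul_B hf hg hl hr k x)
  have hC20 : 0 ≤ C2 := (norm_nonneg _).trans (hB x0 (mem_closedBall_self (by positivity)) 0)
  set C3 := 2 * C1 / R with hC3
  have hL : ∀ x ∈ closedBall x0 (4 * R), ∀ y ∈ closedBall x0 (4 * R), ∀ k : ℕ,
      ‖fderiv ℂ (f.1^[k]) y - fderiv ℂ (f.1^[k]) x‖ ≤ C3 * ‖y - x‖ := by
    intro x hx y hy k
    have hx' : x ∈ closedBall x0 (6 * R) := closedBall_subset_closedBall (by linarith) hx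
    have hy' : y ∈ closedBall x0 (6 * R) := closedBall_subset_closedBall (by linarith) hy
    by_cases hxy : ‖y - x‖ ≤ R
    · have hF : Differentiable ℂ (f.1^[k]) := hf.iterate k
      have h1 : HasFDerivAt (fun z => f.1^[k] (z + (y - x)) - f.1^[k] z)
          (fderiv ℂ (f.1^[k]) y - fderiv ℂ (f.1^[k]) x) x := by
        apply HasFDerivAt.sub _ (hF x).hasFDerivAt
        have : HasFDerivAt (f.1^[k]) (fderiv ℂ (f.1^[k]) y) (x + (y - x)) := by
          rw [add_sub_cancel]; exact (hF y).hasFDerivAt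
        have h2 := this.comp x ((hasFDerivAt_id x).add_const (y - x))
        exact h2
      rw [← h1.fderiv]
      have h3 := cauchyE (F := fun z => f.1^[k] (z + (y - x)) - f.1^[k] z) (x := x) (r := R) (M := C1 * ‖y - x‖) ?_ hR ?_
      · refine h3.trans (le_of_eq ?_)
        rw [hC3]; ring
      · exact (hF.comp (differentiable_id.add_const _)).sub hF
      · intro z hz
        have h5 := Convex.norm_image_sub_le_of_norm_fderiv_le (𝕜 := ℂ) (f := f.1^[k]) (s := closedBall x0 (6 * R)) (C := C1)
          (x := z) (y := z + (y - x)) (fun w _ => hF w) (fun w hw => hA w hw k) (convex_closedBall _ _) ?_ ?_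
        · simpa using h5
        · rw [mem_closedBall] at *
          have := dist_triangle z x x0
          linarith
        · rw [mem_closedBall] at *
          have := dist_triangle z x x0
          have h6 := dist_triangle (z + (y - x)) z x0
          have h7 : dist (z + (y - x)) z = ‖y - x‖ := by rw [dist_eq_norm]; congr 1; abel
          linarith
    · push Not at hxy
      calc _ ≤ ‖fderiv ℂ (f.1^[k]) y‖ + ‖fderiv ℂ (f.1^[k]) x‖ := norm_sub_le _ _
        _ ≤ C1 + C1 := add_le_add (hA y hy' k) (hA x hx' k)
        _ = C3 * R := by rw [hC3]; field_simp; ring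
        _ ≤ _ := by gcongr
  have hC30 : 0 ≤ C3 := by positivity
  have hQ : ∀ x ∈ closedBall x0 (4 * R), ∀ y ∈ closedBall x0 (4 * R), ∀ k : ℕ,
      ‖f.1^[k] y - f.1^[k] x - fderiv ℂ (f.1^[k]) x (y - x)‖ ≤ C3 * ‖y - x‖ ^ 2 := by
    intro x hx y hy k
    have hF : Differentiable ℂ (f.1^[k]) := hf.iterate k
    have := Convex.norm_image_sub_le_of_norm_fderiv_le' (𝕜 := ℂ) (f := f.1^[k]) (φ := fderiv ℂ (f.1^[k]) x)
      (s := closedBall x0 (4 * R) ∩ closedBall x ‖y - x‖) (C := C3 * ‖y - x‖) (x := x) (y := y)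
      (fun w _ => hF w) (fun w hw => ?_) ((convex_closedBall _ _).inter (convex_closedBall _ _))
      ⟨hx, mem_closedBall_self (norm_nonneg _)⟩ ⟨hy, by rw [mem_closedBall, dist_eq_norm]⟩
    · refine this.trans (le_of_eq (by ring))
    · refine (hL x hx w hw.1 k).trans ?_
      have := hw.2
      rw [mem_closedBall, dist_eq_norm] at this
      gcongr
  refine ⟨g, max 1 (max C1 (max C2 C3)), hf, hg, hl, hr, hd, hR, le_max_left _ _, hN, fun x hx k => (hA x hx k).trans (by simp),
    fun x hx k => (hB x hx k).trans (by simp), fun x hx y hy k => (hL x hx y hy k).trans ?_,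
    fun x hx y hy k => (hQ x hx y hy k).trans ?_, ?_⟩
  · gcongr; simp
  · gcongr; simp
  · intro l v hlv h hh
    obtain ⟨M, hM⟩ := bounded_sum f g hg hl hr O hO hfO _ N hb l v hlv h hh
    refine ⟨C2 * M, fun x hx k => ?_⟩
    set S := ∑ j ∈ Finset.range k, Bk f.1 g (j + 1) x (h (l (f.1^[j + 1] x)) • v) with hSd
    have h1 : Bk f.1 g k x (fderiv ℂ (f.1^[k]) x S) = S :=
      congrArg (fun A : En n →L[ℂ] En n => A S) (B_mul hf hg hl k x)
    rw [← h1]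
    refine (ContinuousLinearMap.le_opNorm _ _).trans ?_
    have h2 := hM x (closedBall_subset_closedBall (by linarith) hx) k
    have h3 := hB x hx k
    gcongr


section avg
variable {n : ℕ} {f g : En n → En n} {x0 : En n} {R N C : ℝ}

def AvgZ (f g : En n → En n) (x : En n) (Y : En n → En n) : Prop :=
  Tendsto (fun K : ℕ => (K : ℝ)⁻¹ • ∑ j ∈ Finset.range K, Bk f g (j + 1) x (Y (f^[j + 1] x))) atTop (𝓝 0)

theorem AvgZ.sum {ι : Type*} {x : En n} (s : Finset ι) (Y : ι → En n → En n) (h : ∀ i ∈ s, AvgZ f g x (Y i)) :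
    AvgZ f g x (fun z => ∑ i ∈ s, Y i z) := by
  have := tendsto_finsetSum s h
  simp only [Finset.sum_const_zero] at this
  refine this.congr (fun K => ?_)
  rw [← Finset.smul_sum, Finset.sum_comm]
  simp only [map_sum]

theorem AvgZ.smul {x : En n} {Y : En n → En n} (c : ℂ) (h : AvgZ f g x Y) :
    AvgZ f g x (fun z => c • Y z) := by
  have := Tendsto.const_smul h c
  rw [smul_zero] at this
  refine this.congr (fun K => ?_)
  simp only [map_smul]
  rw [← Finset.smul_sum, smul_comm]

theorem AvgZ.approx (D : Dyn f g x0 R N C) {x : En n} (hx : x ∈ closedBall x0 (6 * R)) {Y : En n → En n}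
    (h : ∀ ε > 0, ∃ Y', AvgZ f g x Y' ∧ ∀ z ∈ closedBall (0 : En n) N, ‖Y z - Y' z‖ ≤ ε) : AvgZ f g x Y := by
  have hC0 : 0 < C := lt_of_lt_of_le one_pos D.hC
  have hR := D.hR
  unfold AvgZ
  rw [Metric.tendsto_atTop]
  intro ε hε
  obtain ⟨Y', hY', hd⟩ := h (ε / (2 * C)) (by positivity)
  unfold AvgZ at hY'
  rw [Metric.tendsto_atTop] at hY'
  obtain ⟨K0, hK0⟩ := hY' (ε / 2) (by positivity)
  refine ⟨K0, fun K hK => ?_⟩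
  have h1 := hK0 K hK
  rw [dist_zero_right] at *
  have h2 : ‖(K : ℝ)⁻¹ • ∑ j ∈ Finset.range K, Bk f g (j + 1) x (Y (f^[j + 1] x)) -
      (K : ℝ)⁻¹ • ∑ j ∈ Finset.range K, Bk f g (j + 1) x (Y' (f^[j + 1] x))‖ ≤ ε / 2 := by
    rw [← smul_sub, ← Finset.sum_sub_distrib, norm_smul, norm_inv, Real.norm_natCast]
    have h3 : ‖∑ j ∈ Finset.range K, (Bk f g (j + 1) x (Y (f^[j + 1] x)) - Bk f g (j + 1) x (Y' (f^[j + 1] x)))‖ ≤ K * (ε / 2) := by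
      refine (norm_sum_le_of_le (Finset.range K) (f := fun j => (Bk f g (j + 1) x (Y (f^[j + 1] x)) - Bk f g (j + 1) x (Y' (f^[j + 1] x)))) (n := fun _ => ε / 2) (fun j _ => ?_)).trans (by simp)
      rw [← map_sub]
      refine (ContinuousLinearMap.le_opNorm _ _).trans ?_
      have h4 := hd (f^[j + 1] x) (by
        rw [mem_closedBall_zero_iff]
        exact D.hN x (closedBall_subset_closedBall (by linarith) hx) _)
      have h5 := D.hB x hx (j + 1)
      calc _ ≤ C * (ε / (2 * C)) := by gcongr
        _ = ε / 2 := by field_simp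
    rcases Nat.eq_zero_or_pos K with rfl | hK
    · simp; positivity
    · have : (0 : ℝ) < K := by exact_mod_cast hK
      rw [inv_mul_le_iff₀ this]
      exact h3
  have := norm_le_norm_add_norm_sub' ((K : ℝ)⁻¹ • ∑ j ∈ Finset.range K, Bk f g (j + 1) x (Y (f^[j + 1] x))) ((K : ℝ)⁻¹ • ∑ j ∈ Finset.range K, Bk f g (j + 1) x (Y' (f^[j + 1] x)))
  linarith

theorem AvgZ.shear (D : Dyn f g x0 R N C) {x : En n} (hx : x ∈ closedBall x0 (6 * R)) (l : En n →L[ℂ] ℂ) (v : En n)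
    (hlv : l v = 0) (h : ℂ → ℂ) (hh : Differentiable ℂ h) : AvgZ f g x (fun z => h (l z) • v) := by
  obtain ⟨M, hM⟩ := D.hS l v hlv h hh
  unfold AvgZ
  apply squeeze_zero_norm (a := fun K : ℕ => (K : ℝ)⁻¹ * M)
  · intro K
    rw [norm_smul, norm_inv, Real.norm_natCast]
    have := hM x hx K
    gcongr
  · simpa using (tendsto_inv_atTop_nhds_zero_nat (𝕜 := ℝ)).mul_const M

theorem AvgZ.wedge (D : Dyn f g x0 R N C) {x : En n} (hx : x ∈ closedBall x0 (6 * R)) {h : En n → ℂ}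
    (hh : Differentiable ℂ h) (v w : En n) : AvgZ f g x (fun z => fderiv ℂ h z w • v - fderiv ℂ h z v • w) := by
  apply AvgZ.approx D hx
  intro ε hε
  set a := 4 * (‖v‖ * ‖w‖) + 1 with ha
  have ha0 : 0 < a := by positivity
  obtain ⟨c, hc⟩ := exp_dense hh (N + 1) (ε / a) (by positivity)
  refine ⟨fun z => ∑ l ∈ c.support, c l • (Complex.exp (l z) • (l w • v - l v • w)), ?_, ?_⟩
  · apply AvgZ.sum
    intro l _
    apply AvgZ.smul
    apply AvgZ.shear D hx l _ _ Complex.exp Complex.differentiable_exp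
    simp; ring
  · intro z hz
    set p : En n → ℂ := fun z => ∑ l ∈ c.support, c l * Complex.exp (l z) with hp
    have hpd : ∀ z, HasFDerivAt p (∑ l ∈ c.support, c l • (Complex.exp (l z) • (l : En n →L[ℂ] ℂ))) z := by
      intro z
      apply HasFDerivAt.fun_sum
      intro l _
      exact (l.hasFDerivAt.cexp).const_mul (c l)
    have hpD : Differentiable ℂ p := fun z => (hpd z).differentiableAt
    have h1 := cauchyE (F := fun z => h z - p z) (x := z) (r := 1) (M := ε / a) (hh.sub hpD) one_pos (by
      intro y hy
      apply hc
      rw [mem_closedBall] at *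
      have := dist_triangle y z 0
      linarith)
    rw [((hh z).hasFDerivAt.fun_sub (hpd z)).fderiv] at h1
    set T := fderiv ℂ h z - ∑ l ∈ c.support, c l • (Complex.exp (l z) • (l : En n →L[ℂ] ℂ)) with hT
    have h2 : fderiv ℂ h z w • v - fderiv ℂ h z v • w - ∑ l ∈ c.support, c l • (Complex.exp (l z) • (l w • v - l v • w)) = T w • v - T v • w := by
      simp only [hT, _root_.sub_apply, _root_.sum_apply, _root_.smul_apply, sub_smul, Finset.sum_smul, smul_sub, Finset.sum_sub_distrib, smul_smul, smul_eq_mul, mul_assoc]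
      abel
    rw [h2]
    have h3 : ‖T w‖ ≤ 2 * (ε / a) / 1 * ‖w‖ := (T.le_opNorm w).trans (by gcongr)
    have h4 : ‖T v‖ ≤ 2 * (ε / a) / 1 * ‖v‖ := (T.le_opNorm v).trans (by gcongr)
    calc _ ≤ ‖T w • v‖ + ‖T v • w‖ := norm_sub_le _ _
      _ = ‖T w‖ * ‖v‖ + ‖T v‖ * ‖w‖ := by rw [norm_smul, norm_smul]
      _ ≤ (2 * (ε / a) / 1 * ‖w‖) * ‖v‖ + (2 * (ε / a) / 1 * ‖v‖) * ‖w‖ := by gcongr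
      _ = (ε / a) * (4 * (‖v‖ * ‖w‖)) := by ring
      _ ≤ (ε / a) * a := by gcongr; linarith
      _ = ε := by field_simp

theorem trace_En (T : En n →L[ℂ] En n) : LinearMap.trace ℂ (En n) T = ∑ i, (T (EuclideanSpace.single i 1)) i := by
  rw [LinearMap.trace_eq_matrix_trace ℂ (EuclideanSpace.basisFun (Fin n) ℂ).toBasis, Matrix.trace]
  apply Finset.sum_congr rfl
  intro i _
  rw [Matrix.diag_apply, LinearMap.toMatrix_apply]
  simp

theorem apply_En (T : En n →L[ℂ] En n) (z : En n) : T z = ∑ l, z l • T (EuclideanSpace.single l 1) := by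
  have : z = ∑ l, z l • EuclideanSpace.single l (1 : ℂ) := by
    have := (EuclideanSpace.basisFun (Fin n) ℂ).sum_repr z
    simpa using this.symm
  conv_lhs => rw [this]
  simp

theorem AvgZ.main (D : Dyn f g x0 R N C) {x : En n} (hx : x ∈ closedBall x0 (6 * R)) {X : En n → En n}
    (hX : Differentiable ℂ X) :
    AvgZ f g x (fun z => fderiv ℂ X z z + ((n : ℂ) - 1) • X z - (LinearMap.trace ℂ (En n) (fderiv ℂ X z)) • z) := by
  have hXi : ∀ i, Differentiable ℂ (fun z => X z i) := fun i => (EuclideanSpace.proj (𝕜 := ℂ) i : En n →L[ℂ] ℂ).differentiable.comp hX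
  have hzl : ∀ l : Fin n, Differentiable ℂ (fun z : En n => z l) := fun l => (EuclideanSpace.proj (𝕜 := ℂ) l : En n →L[ℂ] ℂ).differentiable
  have h1 : AvgZ f g x (fun z => ∑ i : Fin n, ∑ l : Fin n, (fderiv ℂ (fun z => X z i * z l) z (EuclideanSpace.single l 1) • EuclideanSpace.single i 1
      - fderiv ℂ (fun z => X z i * z l) z (EuclideanSpace.single i 1) • EuclideanSpace.single l 1)) := by
    apply AvgZ.sum
    intro i _
    apply AvgZ.sum
    intro l _
    exact AvgZ.wedge D hx ((hXi i).mul (hzl l)) _ _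
  convert h1 using 1
  ext1 z
  have hd : ∀ i l : Fin n, ∀ w, fderiv ℂ (fun z => X z i * z l) z w = X z i * w l + z l * (fderiv ℂ X z w) i := by
    intro i l w
    have h2 : HasFDerivAt (fun z => X z i) ((EuclideanSpace.proj (𝕜 := ℂ) i : En n →L[ℂ] ℂ).comp (fderiv ℂ X z)) z :=
      (EuclideanSpace.proj (𝕜 := ℂ) i : En n →L[ℂ] ℂ).hasFDerivAt.comp z (hX z).hasFDerivAt
    have h3 : HasFDerivAt (fun z : En n => z l) (EuclideanSpace.proj (𝕜 := ℂ) l : En n →L[ℂ] ℂ) z :=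
      (EuclideanSpace.proj (𝕜 := ℂ) l : En n →L[ℂ] ℂ).hasFDerivAt
    rw [(h2.fun_mul h3).fderiv]
    simp
  simp only [hd]
  rw [trace_En]
  conv_lhs => rw [apply_En (fderiv ℂ X z) z]
  ext k
  simp [Finset.sum_sub_distrib, sub_smul, Finset.sum_add_distrib, Finset.sum_mul, Pi.single_apply]
  simp only [mul_comm _ (z.ofLp k)]
  ring
end avg


section mainest
variable {n : ℕ} {f g : En n → En n} {x0 : En n} {R N C : ℝ}

theorem tele_bound {E : Type*} [NormedAddCommGroup E] (a : ℕ → E) (M : ℝ) (h : ∀ i, ‖a i‖ ≤ M) (m K : ℕ) :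
    ‖∑ j ∈ Finset.range K, (a (j + 1) - a (m + (j + 1)))‖ ≤ m * (2 * M) := by
  induction m with
  | zero => simp
  | succ m ih =>
    have e1 : ∑ j ∈ Finset.range K, (a (j + 1) - a (m + 1 + (j + 1))) =
        ∑ j ∈ Finset.range K, (a (j + 1) - a (m + (j + 1))) +
        ∑ j ∈ Finset.range K, (a (m + 1 + j) - a (m + 1 + (j + 1))) := by
      rw [← Finset.sum_add_distrib]
      apply Finset.sum_congr rfl
      intro j _
      rw [show m + (j + 1) = m + 1 + j by ring]
      abel
    have e2 := Finset.sum_range_sub' (fun j => a (m + 1 + j)) K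
    rw [e1, e2]
    refine (norm_add_le _ _).trans ?_
    have h2 := norm_sub_le (a (m + 1 + 0)) (a (m + 1 + K))
    have h3 := h (m + 1 + 0)
    have h4 := h (m + 1 + K)
    push_cast
    linarith

theorem step_est (D : Dyn f g x0 R N C) (m : ℕ) {x : En n} (hx : x ∈ closedBall x0 (3 * R)) {ε : ℝ}
    (h1 : ‖f^[m] x - x‖ ≤ ε) (h2 : ‖fderiv ℂ (f^[m]) x - 1‖ ≤ ε) (hεR : ε ≤ R) (hε1 : ε ≤ 1)
    (j : ℕ) : ‖fderiv ℂ (f^[m]) (f^[j] x) - 1‖ ≤ 2 * C ^ 3 * ε ∧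
      ‖Bk f g j x (f^[m] (f^[j] x) - f^[j] x) - (f^[m] x - x)‖ ≤ C ^ 2 * ε ^ 2 ∧
      ‖f^[m] (f^[j] x) - f^[j] x‖ ≤ 2 * C * ε ∧
      Bk f g (m + j) x * fderiv ℂ (f^[m]) (f^[j] x) = Bk f g j x := by
  have hC := D.hC
  have hC0 : 0 < C := lt_of_lt_of_le one_pos D.hC
  have hR := D.hR
  have hε0 : 0 ≤ ε := (norm_nonneg _).trans h1
  have hx4 : x ∈ closedBall x0 (4 * R) := closedBall_subset_closedBall (by linarith) hx
  have hx6 : x ∈ closedBall x0 (6 * R) := closedBall_subset_closedBall (by linarith) hx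
  have hy4 : f^[m] x ∈ closedBall x0 (4 * R) := by
    rw [← dist_eq_norm] at h1
    rw [mem_closedBall] at *
    have := dist_triangle (f^[m] x) x x0
    linarith
  have hAB := mul_B D.hf D.hg D.hl D.hr j x
  have hcomm : f^[m] (f^[j] x) = f^[j] (f^[m] x) := by
    rw [← Function.iterate_add_apply, ← Function.iterate_add_apply, Nat.add_comm]
  have e1 : fderiv ℂ (f^[m]) (f^[j] x) * fderiv ℂ (f^[j]) x = fderiv ℂ (f^[j]) (f^[m] x) * fderiv ℂ (f^[m]) x := by
    rw [← fderiv_iter_add D.hf, ← fderiv_iter_add D.hf, Nat.add_comm]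
  have e2 : fderiv ℂ (f^[m]) (f^[j] x) - 1 = ((fderiv ℂ (f^[j]) (f^[m] x) - fderiv ℂ (f^[j]) x) * fderiv ℂ (f^[m]) x + fderiv ℂ (f^[j]) x * (fderiv ℂ (f^[m]) x - 1)) * Bk f g j x := by
    have : fderiv ℂ (f^[m]) (f^[j] x) = (fderiv ℂ (f^[j]) (f^[m] x) * fderiv ℂ (f^[m]) x) * Bk f g j x := by
      rw [← e1, mul_assoc, hAB, mul_one]
    rw [this]
    conv_lhs => rw [← hAB]
    rw [add_mul, mul_sub, sub_mul, sub_mul, mul_one, sub_mul]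
    abel
  have bL := D.hL x hx4 _ hy4 j
  have bAm := D.hA x hx6 m
  have bAj := D.hA x hx6 j
  have bB := D.hB x hx6 j
  have bQ := D.hQ x hx4 _ hy4 j
  refine ⟨?_, ?_, ?_, ?_⟩
  · rw [e2]
    calc _ ≤ ‖(fderiv ℂ (f^[j]) (f^[m] x) - fderiv ℂ (f^[j]) x) * fderiv ℂ (f^[m]) x + fderiv ℂ (f^[j]) x * (fderiv ℂ (f^[m]) x - 1)‖ * ‖Bk f g j x‖ := norm_mul_le _ _
      _ ≤ ((C * ε) * C + C * ε) * C := by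
        gcongr
        refine (norm_add_le _ _).trans (add_le_add ((norm_mul_le _ _).trans ?_) ((norm_mul_le _ _).trans ?_))
        · have : ‖fderiv ℂ (f^[j]) (f^[m] x) - fderiv ℂ (f^[j]) x‖ ≤ C * ε := bL.trans (by gcongr)
          gcongr
        · gcongr
      _ ≤ _ := by
        have : C ^ 2 * ε ≤ C ^ 3 * ε := by gcongr <;> simp
        linarith
  · have e3 : Bk f g j x (f^[m] (f^[j] x) - f^[j] x) - (f^[m] x - x) = Bk f g j x (f^[j] (f^[m] x) - f^[j] x - fderiv ℂ (f^[j]) x (f^[m] x - x)) := by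
      have := congrArg (fun A : En n →L[ℂ] En n => A (f^[m] x - x)) (B_mul D.hf D.hg D.hl j x)
      have h4 : Bk f g j x (fderiv ℂ (f^[j]) x (f^[m] x - x)) = f^[m] x - x := this
      rw [map_sub _ (f^[j] (f^[m] x) - f^[j] x), h4, hcomm]
    rw [e3]
    calc _ ≤ ‖Bk f g j x‖ * _ := ContinuousLinearMap.le_opNorm _ _
      _ ≤ C * (C * ε ^ 2) := by
        have := bQ.trans (show C * ‖f^[m] x - x‖ ^ 2 ≤ C * ε ^ 2 by gcongr)
        gcongr
      _ = _ := by ring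
  · rw [hcomm]
    have h5 : ‖fderiv ℂ (f^[j]) x (f^[m] x - x)‖ ≤ C * ε := (ContinuousLinearMap.le_opNorm _ _).trans (by gcongr)
    have h6 := norm_le_norm_sub_add (f^[j] (f^[m] x) - f^[j] x) (fderiv ℂ (f^[j]) x (f^[m] x - x))
    have h7 : C * ‖f^[m] x - x‖ ^ 2 ≤ C * ε := by
      have : ‖f^[m] x - x‖ ^ 2 ≤ ε ^ 2 := by gcongr
      have h8 : ε ^ 2 ≤ ε := by nlinarith
      gcongr
      linarith
    linarith
  · have h8 := B_mul D.hf D.hg D.hl (m + j) x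
    rw [fderiv_iter_add D.hf, ← mul_assoc] at h8
    calc _ = Bk f g (m + j) x * fderiv ℂ (f^[m]) (f^[j] x) * (fderiv ℂ (f^[j]) x * Bk f g j x) := by rw [hAB, mul_one]
      _ = _ := by rw [← mul_assoc, h8, one_mul]

theorem main_est (D : Dyn f g x0 R N C) : ∃ C' ε0 : ℝ, 0 < C' ∧ 0 < ε0 ∧ ∀ (m : ℕ) (x : En n), x ∈ closedBall x0 (3 * R) →
    ∀ ε : ℝ, ‖f^[m] x - x‖ ≤ ε → ‖fderiv ℂ (f^[m]) x - 1‖ ≤ ε → ε ≤ ε0 → n * ‖f^[m] x - x‖ ≤ C' * ε ^ 2 := by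
  obtain ⟨Cd, hCd0, hCd⟩ := det_est n
  have hC := D.hC
  have hC0 : 0 < C := lt_of_lt_of_le one_pos D.hC
  have hR := D.hR
  have hN0 : 0 ≤ N := (norm_nonneg _).trans (D.hN x0 (mem_closedBall_self (by positivity)) 0)
  set C1 := 2 * C ^ 3 with hC1
  have hC10 : 0 < C1 := by positivity
  set C' := n * C ^ 2 + C * C1 ^ 2 * N + C * C1 * (2 * C) + Cd * C1 ^ 2 * (C * N) + 1 with hC'
  refine ⟨C', min (min R 1) (1 / (2 * C1)), by positivity, by positivity, ?_⟩
  intro m x hx ε h1 h2 hε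
  have hεR : ε ≤ R := hε.trans ((min_le_left _ _).trans (min_le_left _ _))
  have hε1 : ε ≤ 1 := hε.trans ((min_le_left _ _).trans (min_le_right _ _))
  have hεC : C1 * ε < 1 := by
    have : ε ≤ 1 / (2 * C1) := hε.trans (min_le_right _ _)
    calc C1 * ε ≤ C1 * (1 / (2 * C1)) := by gcongr
      _ = 1 / 2 := by field_simp
      _ < 1 := by norm_num
  have hε0 : 0 ≤ ε := (norm_nonneg _).trans h1
  have hx6 : x ∈ closedBall x0 (6 * R) := closedBall_subset_closedBall (by linarith) hx
  have hx8 : x ∈ closedBall x0 (8 * R) := closedBall_subset_closedBall (by linarith) hx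
  have hFm : Differentiable ℂ (f^[m]) := D.hf.iterate m
  have hXd : Differentiable ℂ (fun z => f^[m] z - z) := hFm.sub differentiable_id
  have hDX : ∀ z, fderiv ℂ (fun z => f^[m] z - z) z = fderiv ℂ (f^[m]) z - 1 := by
    intro z
    exact ((hFm z).hasFDerivAt.fun_sub (hasFDerivAt_id z)).fderiv
  have hav := AvgZ.main D hx6 hXd
  unfold AvgZ at hav
  simp only [hDX] at hav
  set W : ℕ → En n := fun j => Bk f g j x ((fderiv ℂ (f^[m]) (f^[j] x) - 1) (f^[j] x) + ((n : ℂ) - 1) • (f^[m] (f^[j] x) - f^[j] x) - (LinearMap.trace ℂ (En n) ((fderiv ℂ (f^[m]) (f^[j] x) - 1 : En n →L[ℂ] En n))) • (f^[j] x)) with hW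
  set a : ℕ → En n := fun j => Bk f g j x (f^[j] x) with ha
  have key : ∀ j, ‖W j - (a j - a (m + j)) - (n : ℂ) • (f^[m] x - x)‖ ≤ C' * ε ^ 2 := by
    intro j
    obtain ⟨b1, b2, b3, b4⟩ := step_est D m hx h1 h2 hεR hε1 j
    set T := fderiv ℂ (f^[m]) (f^[j] x) - 1 with hT
    have hT1 : fderiv ℂ (f^[m]) (f^[j] x) = 1 + T := by rw [hT]; abel
    rw [hT1] at b4
    set P := Bk f g (m + j) x with hP
    set B := Bk f g j x with hB
    set y := f^[j] x with hy
    set Xy := f^[m] y - y with hXy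
    have htr : ‖LinearMap.trace ℂ (En n) (T : En n →L[ℂ] En n)‖ ≤ Cd * C1 ^ 2 * ε ^ 2 := by
      refine (hCd T (lt_of_le_of_lt b1 hεC) ?_).trans ?_
      · rw [← hT1]; exact det_iter D.hf D.hd m _
      · calc _ ≤ Cd * (C1 * ε) ^ 2 := by gcongr
          _ = _ := by ring
    set τ := LinearMap.trace ℂ (En n) (T : En n →L[ℂ] En n) with hτ
    have e1 : a (m + j) = P (y + Xy) := by
      simp only [ha, hP, hXy, hy]
      rw [Function.iterate_add_apply]
      congr 1
      abel
    have hBv : ∀ v, B v = P v + P (T v) := by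
      intro v
      have := congrArg (fun A : En n →L[ℂ] En n => A v) b4
      simpa using this.symm
    have e2 : W j - (a j - a (m + j)) - (n : ℂ) • (f^[m] x - x) =
        (n : ℂ) • (B Xy - (f^[m] x - x)) + P (T (T y)) - P (T Xy) - τ • B y := by
      have e3 : W j = B (T y) + ((n : ℂ) - 1) • B Xy - τ • B y := by
        simp only [hW]
        rw [map_sub, map_add, map_smul, map_smul]
      have e4 : a j = B y := rfl
      rw [e3, e1, e4, map_add, sub_smul, smul_sub, one_smul, hBv (T y), hBv Xy, hBv y]
      module
    rw [e2]
    have hyN : ‖y‖ ≤ N := D.hN x hx8 j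
    have bP : ‖P‖ ≤ C := D.hB x hx6 _
    have bB : ‖B‖ ≤ C := D.hB x hx6 _
    have t1 : ‖(n : ℂ) • (B Xy - (f^[m] x - x))‖ ≤ n * (C ^ 2 * ε ^ 2) := by
      rw [norm_smul, Complex.norm_natCast]; gcongr
    have t0 : ∀ v M, ‖v‖ ≤ M → ‖T v‖ ≤ (C1 * ε) * M := fun v M hv => (T.le_opNorm v).trans (by gcongr)
    have tP : ∀ v M, ‖v‖ ≤ M → ‖P v‖ ≤ C * M := fun v M hv => (P.le_opNorm v).trans (by gcongr)
    have t2 := tP _ _ (t0 _ _ (t0 _ _ hyN))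
    have t3 := tP _ _ (t0 _ _ b3)
    have t4 : ‖τ • B y‖ ≤ (Cd * C1 ^ 2 * ε ^ 2) * (C * N) := by
      rw [norm_smul]
      have : ‖B y‖ ≤ C * N := (B.le_opNorm y).trans (by gcongr)
      gcongr
    have s1 := norm_sub_le ((n : ℂ) • (B Xy - (f^[m] x - x)) + P (T (T y)) - P (T Xy)) (τ • B y)
    have s2 := norm_sub_le ((n : ℂ) • (B Xy - (f^[m] x - x)) + P (T (T y))) (P (T Xy))
    have s3 := norm_add_le ((n : ℂ) • (B Xy - (f^[m] x - x))) (P (T (T y)))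
    have s4 : 0 ≤ ε ^ 2 := by positivity
    rw [hC']
    nlinarith
  have ha' : ∀ i, ‖a i‖ ≤ C * N := fun i => by
    refine (ContinuousLinearMap.le_opNorm _ _).trans ?_
    have := D.hB x hx6 i
    have := D.hN x hx8 i
    gcongr
  have hlim : Tendsto (fun K : ℕ => ‖(K : ℝ)⁻¹ • ∑ j ∈ Finset.range K, W (j + 1)‖ + (K : ℝ)⁻¹ * (m * (2 * (C * N))) + C' * ε ^ 2) atTop (𝓝 (C' * ε ^ 2)) := by
    have hav' : Tendsto (fun K : ℕ => (K : ℝ)⁻¹ • ∑ j ∈ Finset.range K, W (j + 1)) atTop (𝓝 0) := hav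
    clear_value W
    have := ((tendsto_norm_zero.comp hav').add ((tendsto_inv_atTop_nhds_zero_nat (𝕜 := ℝ)).mul_const (m * (2 * (C * N))))).add_const (C' * ε ^ 2)
    simpa using this
  apply ge_of_tendsto hlim
  filter_upwards [eventually_gt_atTop 0] with K hK
  have hK' : (0 : ℝ) < K := by exact_mod_cast hK
  have s1 : ‖∑ j ∈ Finset.range K, (W (j + 1) - (a (j + 1) - a (m + (j + 1))) - (n : ℂ) • (f^[m] x - x))‖ ≤ K * (C' * ε ^ 2) := by
    refine (norm_sum_le_of_le (n := fun _ => C' * ε ^ 2) _ (fun j _ => key (j + 1))).trans (by simp)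
  rw [Finset.sum_sub_distrib, Finset.sum_sub_distrib, Finset.sum_const, Finset.card_range] at s1
  have s2 := tele_bound a _ ha' m K
  set S1 := ∑ j ∈ Finset.range K, W (j + 1)
  set S2 := ∑ j ∈ Finset.range K, (a (j + 1) - a (m + (j + 1)))
  have s3 : ‖K • (n : ℂ) • (f^[m] x - x)‖ = K * (n * ‖f^[m] x - x‖) := by
    rw [← Nat.cast_smul_eq_nsmul ℂ, norm_smul, norm_smul, Complex.norm_natCast, Complex.norm_natCast]
  have s4 : ‖K • (n : ℂ) • (f^[m] x - x)‖ ≤ ‖S1‖ + ‖S2‖ + ‖S1 - S2 - K • (n : ℂ) • (f^[m] x - x)‖ := by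
    have := norm_sub_le (S1 - S2) (S1 - S2 - K • (n : ℂ) • (f^[m] x - x))
    rw [sub_sub_cancel] at this
    have h5 := norm_sub_le S1 S2
    linarith
  rw [norm_smul, norm_inv, Real.norm_natCast]
  rw [s3] at s4
  have s5 : K * (n * ‖f^[m] x - x‖) ≤ ‖S1‖ + m * (2 * (C * N)) + K * (C' * ε ^ 2) := by linarith
  calc (n : ℝ) * ‖f^[m] x - x‖ = (K : ℝ)⁻¹ * (K * (n * ‖f^[m] x - x‖)) := by field_simp
    _ ≤ (K : ℝ)⁻¹ * (‖S1‖ + m * (2 * (C * N)) + K * (C' * ε ^ 2)) := by gcongr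
    _ = _ := by field_simp
end mainest


section recur
variable {n : ℕ} {f g : En n → En n} {x0 : En n} {R N C : ℝ}

theorem lip6 (D : Dyn f g x0 R N C) (k : ℕ) {x y : En n} (hx : x ∈ closedBall x0 (6 * R)) (hy : y ∈ closedBall x0 (6 * R)) :
    ‖f^[k] y - f^[k] x‖ ≤ C * ‖y - x‖ :=
  Convex.norm_image_sub_le_of_norm_fderiv_le (𝕜 := ℂ) (fun w _ => D.hf.iterate k w) (fun w hw => D.hA w hw k)
    (convex_closedBall _ _) hx hy

theorem pigeon {E ι : Type*} [NormedAddCommGroup E] [ProperSpace E] (hι : Finite ι) (u : ℕ → ι → E) (N : ℝ)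
    (hu : ∀ k i, ‖u k i‖ ≤ N) {μ : ℝ} (hμ : 0 < μ) : ∃ k l : ℕ, k < l ∧ ∀ i, dist (u l i) (u k i) < μ := by
  have := Fintype.ofFinite ι
  have hu' : ∀ k, u k ∈ closedBall (0 : ι → E) |N| := by
    intro k
    rw [mem_closedBall_zero_iff]
    rw [pi_norm_le_iff_of_nonneg (abs_nonneg _)]
    intro z
    exact (hu k z).trans (le_abs_self _)
  obtain ⟨a, -, φ, hφ, hlim⟩ := tendsto_subseq_of_bounded (isBounded_closedBall) hu'
  have hc := hlim.cauchySeq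
  rw [Metric.cauchySeq_iff] at hc
  obtain ⟨M, hM⟩ := hc μ hμ
  have h1 := hM (M + 1) (by omega) M (by omega)
  exact ⟨φ M, φ (M + 1), hφ (by omega), fun i => (dist_le_pi_dist _ _ i).trans_lt h1⟩

theorem recur1 (D : Dyn f g x0 R N C) {μ : ℝ} (hμ : 0 < μ) :
    ∃ k l : ℕ, k < l ∧ ∀ x ∈ closedBall x0 (3 * R), ‖f^[l] x - f^[k] x‖ ≤ μ := by
  have hC0 : 0 < C := lt_of_lt_of_le one_pos D.hC
  have hR := D.hR
  obtain ⟨t, hts, htf, htc⟩ := (isCompact_closedBall x0 (3 * R)).finite_cover_balls (e := μ / (3 * C)) (by positivity)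
  obtain ⟨k, l, hkl, hu⟩ := pigeon (ι := t) htf (fun k z => f^[k] z) N (fun k z => 
    D.hN _ (closedBall_subset_closedBall (by linarith) (hts z.2)) k) (μ := μ / 3) (by positivity)
  refine ⟨k, l, hkl, fun x hx => ?_⟩
  obtain ⟨z, hzt, hxz⟩ := mem_iUnion₂.1 (htc hx)
  have hx6 : x ∈ closedBall x0 (6 * R) := closedBall_subset_closedBall (by linarith) hx
  have hz6 : z ∈ closedBall x0 (6 * R) := closedBall_subset_closedBall (by linarith) (hts hzt)
  have h2 : dist (f^[l] z) (f^[k] z) < μ / 3 := hu ⟨z, hzt⟩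
  rw [← dist_eq_norm]
  have h3 : ∀ k, dist (f^[k] x) (f^[k] z) ≤ μ / 3 := by
    intro k
    rw [dist_eq_norm]
    refine (lip6 D k hz6 hx6).trans ?_
    rw [mem_ball, dist_eq_norm] at hxz
    calc _ ≤ C * (μ / (3 * C)) := by gcongr
      _ = _ := by field_simp
  have h4 := dist_triangle4 (f^[l] x) (f^[l] z) (f^[k] z) (f^[k] x)
  have h5 := h3 (k)
  rw [dist_comm] at h5
  have h6 := h3 (l)
  linarith

theorem recur (D : Dyn f g x0 R N C) {η : ℝ} (hη : 0 < η) :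
    ∃ p : ℕ, 0 < p ∧ ∀ x ∈ closedBall x0 (3 * R), ‖f^[p] x - x‖ ≤ η := by
  have hC0 : 0 < C := lt_of_lt_of_le one_pos D.hC
  have hR := D.hR
  set s := min η (min R (1 / (2 * C ^ 2))) with hs
  have hs0 : 0 < s := by positivity
  have hsη : s ≤ η := min_le_left _ _
  have hsR : s ≤ R := (min_le_right _ _).trans (min_le_left _ _)
  have hsC : C * s ≤ 1 / (2 * C) := by
    have : s ≤ 1 / (2 * C ^ 2) := (min_le_right _ _).trans (min_le_right _ _)
    calc C * s ≤ C * (1 / (2 * C ^ 2)) := by gcongr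
      _ = _ := by field_simp
  obtain ⟨k, l, hkl, hd⟩ := recur1 D (μ := s / (2 * C)) (by positivity)
  refine ⟨l - k, by omega, fun x hx => ?_⟩
  have hsub : closedBall x s ⊆ closedBall x0 (4 * R) := by
    intro z hz
    rw [mem_closedBall] at *
    have := dist_triangle z x x0
    linarith
  have happ : ApproximatesLinearOn (f^[k]) (fderiv ℂ (f^[k]) x) (closedBall x s) ⟨C * s, by positivity⟩ := by
    intro y hy z hz
    refine Convex.norm_image_sub_le_of_norm_fderiv_le' (𝕜 := ℂ) (fun w _ => D.hf.iterate k w) (fun w hw => ?_)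
      (convex_closedBall x s) hz hy
    refine (D.hL x (hsub (mem_closedBall_self hs0.le)) w (hsub hw) k).trans ?_
    rw [mem_closedBall, dist_eq_norm] at hw
    show _ ≤ C * s
    gcongr
  let inv : (fderiv ℂ (f^[k]) x).NonlinearRightInverse :=
    { toFun := Bk f g k x
      nnnorm := ⟨C, hC0.le⟩
      bound' := fun y => (ContinuousLinearMap.le_opNorm _ _).trans (by
        have := D.hB x (closedBall_subset_closedBall (by linarith) hx) k
        show _ ≤ C * ‖y‖
        gcongr)
      right_inv' := fun y => congrArg (fun A : En n →L[ℂ] En n => A y) (mul_B D.hf D.hg D.hl D.hr k x) }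
  have hsurj := happ.surjOn_closedBall_of_nonlinearRightInverse inv hs0.le subset_rfl
  have hmem : f^[l] x ∈ closedBall (f^[k] x) ((C⁻¹ - C * s) * s) := by
    rw [mem_closedBall, dist_eq_norm]
    refine (hd x hx).trans ?_
    have : 1 / (2 * C) ≤ C⁻¹ - C * s := by
      have : C⁻¹ = 1 / (2 * C) + 1 / (2 * C) := by field_simp; norm_num
      linarith
    calc s / (2 * C) = 1 / (2 * C) * s := by ring
      _ ≤ _ := by gcongr
  obtain ⟨y, hy, hyl⟩ := hsurj hmem
  have e1 : f^[l] x = f^[k] (f^[l - k] x) := by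
    rw [← Function.iterate_add_apply]; congr 2; omega
  rw [e1] at hyl
  have := (D.hl.injective.iterate k) hyl
  rw [← this, ← dist_eq_norm]
  exact (mem_closedBall.1 hy).trans hsη
end recur


section dbl
variable {n : ℕ} {f g : En n → En n} {x0 : En n} {R N C : ℝ}

theorem fd_sub_id (D : Dyn f g x0 R N C) (m : ℕ) (z : En n) :
    fderiv ℂ (fun z => f^[m] z - z) z = fderiv ℂ (f^[m]) z - 1 :=
  ((D.hf.iterate m z).hasFDerivAt.fun_sub (hasFDerivAt_id z)).fderiv

theorem dbl (D : Dyn f g x0 R N C) {p : ℕ} {δ : ℝ} (hδ : δ ≤ R / 4) {x : En n} (hx : x ∈ closedBall x0 R)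
    (hp : ∀ z ∈ closedBall x0 (3 * R), ‖f^[p] z - z‖ ≤ δ) (k : ℕ)
    (hk : ∀ i < k, ∀ z ∈ closedBall x0 (3 * R), ‖f^[i * p] z - z‖ ≤ δ) :
    ‖f^[k * p] x - x - (k : ℝ) • (f^[p] x - x)‖ ≤ k / 2 * ‖f^[p] x - x‖ := by
  have hR := D.hR
  induction k with
  | zero => simp
  | succ k ih =>
    have ih' := ih (fun i hi => hk i (by omega))
    have hX := hk k (by omega)
    have hpx := hp x (closedBall_subset_closedBall (by linarith) hx)
    have hy : f^[p] x ∈ closedBall x0 (2 * R) := by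
      rw [← dist_eq_norm] at hpx
      rw [mem_closedBall] at *
      have := dist_triangle (f^[p] x) x x0
      linarith
    have hXd : Differentiable ℂ (fun z => f^[k * p] z - z) := (D.hf.iterate _).sub differentiable_id
    have h1 : ‖(f^[k * p] (f^[p] x) - f^[p] x) - (f^[k * p] x - x)‖ ≤ 1 / 2 * ‖f^[p] x - x‖ := by
      apply Convex.norm_image_sub_le_of_norm_fderiv_le (𝕜 := ℂ) (f := fun z => f^[k * p] z - z) (s := closedBall x0 (2 * R))
        (fun w _ => hXd w) (fun w hw => ?_) (convex_closedBall _ _) (closedBall_subset_closedBall (by linarith) hx) hy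
      refine (cauchyE hXd (M := δ) (r := R) hR (fun z hz => hX z ?_)).trans ?_
      · rw [mem_closedBall] at *
        have := dist_triangle z w x0
        linarith
      · rw [div_le_iff₀ hR]; linarith
    have e1 : f^[(k + 1) * p] x = f^[k * p] (f^[p] x) := by
      rw [← Function.iterate_add_apply]; congr 2; ring
    have e2 : f^[(k + 1) * p] x - x - ((k + 1 : ℕ) : ℝ) • (f^[p] x - x) =
        (f^[k * p] x - x - (k : ℝ) • (f^[p] x - x)) + ((f^[k * p] (f^[p] x) - f^[p] x) - (f^[k * p] x - x)) := by
      rw [e1]; push_cast; module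
    rw [e2]
    refine (norm_add_le _ _).trans ?_
    push_cast
    linarith

theorem fin_order (D : Dyn f g x0 R N C) (hn : 1 ≤ n) : ∃ p : ℕ, 0 < p ∧ ∀ x ∈ closedBall x0 R, f^[p] x = x := by
  have hR := D.hR
  obtain ⟨C', ε0, hC', hε0, hest⟩ := main_est D
  set δ := R / 4 with hδ
  have hδ0 : 0 < δ := by positivity
  obtain ⟨η1, hη1, h3c⟩ := three_circles (n := n) (N + N) δ R hδ0 hR x0
  set c1 := 2 * δ + 8 * δ / R with hc1
  set c2 := 1 + 2 / R with hc2
  have hc10 : 0 < c1 := by positivity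
  have hc20 : 0 < c2 := by positivity
  set η := min δ (min (ε0 / c2) (η1 / (3 * C' * c1 * c2))) with hη
  have hη0 : 0 < η := by positivity
  have hηδ : η ≤ δ := min_le_left _ _
  have hηε : c2 * η ≤ ε0 := by
    have : η ≤ ε0 / c2 := (min_le_right _ _).trans (min_le_left _ _)
    rw [le_div_iff₀ hc20] at this
    linarith
  have hηη : 3 * C' * c1 * c2 * η ≤ η1 := by
    have : η ≤ η1 / (3 * C' * c1 * c2) := (min_le_right _ _).trans (min_le_right _ _)
    rw [le_div_iff₀ (by positivity)] at this
    linarith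
  obtain ⟨p, hp0, hp⟩ := recur D hη0
  refine ⟨p, hp0, ?_⟩
  have hpδ : ∀ z ∈ closedBall x0 (3 * R), ‖f^[p] z - z‖ ≤ δ := fun z hz => (hp z hz).trans hηδ
  by_cases hall : ∀ i : ℕ, ∀ z ∈ closedBall x0 (3 * R), ‖f^[i * p] z - z‖ ≤ δ
  · intro x hx
    by_contra hne
    have hpos : 0 < ‖f^[p] x - x‖ := norm_pos_iff.2 (sub_ne_zero.2 hne)
    obtain ⟨k, hk⟩ := exists_nat_gt (2 * δ / ‖f^[p] x - x‖)
    rw [div_lt_iff₀ hpos] at hk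
    have h1 := dbl D le_rfl hx hpδ k (fun i _ => hall i)
    have h2 := hall k x (closedBall_subset_closedBall (by linarith) hx)
    have h3 := norm_sub_norm_le ((k : ℝ) • (f^[p] x - x)) (f^[k * p] x - x)
    rw [norm_sub_rev ((k : ℝ) • (f^[p] x - x)), norm_smul, Real.norm_natCast] at h3
    linarith
  · exfalso
    push Not at hall
    classical
    have hspec := Nat.find_spec hall
    have hmin : ∀ i < Nat.find hall, ∀ z ∈ closedBall x0 (3 * R), ‖f^[i * p] z - z‖ ≤ δ := by
      intro i hi
      have := Nat.find_min hall hi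
      push Not at this
      exact this
    set K := Nat.find hall with hK
    have hK0 : K ≠ 0 := by
      intro h
      rw [h] at hspec
      obtain ⟨z, hz, h1⟩ := hspec
      simp at h1
      linarith
    have hK1 : K ≠ 1 := by
      intro h
      rw [h] at hspec
      obtain ⟨z, hz, h1⟩ := hspec
      rw [one_mul] at h1
      linarith [hpδ z hz]
    obtain ⟨k, hk⟩ : ∃ k, K = k + 1 := ⟨K - 1, by omega⟩
    have hk1 : 1 ≤ k := by omega
    have hk1' : (1 : ℝ) ≤ k := by exact_mod_cast hk1
    have hb1 : ∀ x ∈ closedBall x0 R, ‖f^[p] x - x‖ ≤ 2 * δ / k := by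
      intro x hx
      have h1 := dbl D le_rfl hx hpδ k (fun i hi => hmin i (by omega))
      have h2 := hmin k (by omega) x (closedBall_subset_closedBall (by linarith) hx)
      have h3 := norm_sub_norm_le ((k : ℝ) • (f^[p] x - x)) (f^[k * p] x - x)
      rw [norm_sub_rev ((k : ℝ) • (f^[p] x - x)), norm_smul, Real.norm_natCast] at h3
      rw [le_div_iff₀ (by linarith)]
      linarith
    have hXd : Differentiable ℂ (fun z => f^[p] z - z) := (D.hf.iterate _).sub differentiable_id
    have hb2 : ∀ x ∈ closedBall x0 (R / 2), ‖f^[p] x - x‖ ≤ C' * c1 * c2 * η / k := by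
      intro x hx
      have hxR : x ∈ closedBall x0 R := closedBall_subset_closedBall (by linarith) hx
      have hx3 : x ∈ closedBall x0 (3 * R) := closedBall_subset_closedBall (by linarith) hx
      set ε := min (c1 / k) (c2 * η) with hε
      have hεp : 0 ≤ ε := by positivity
      have d1 := cauchyE hXd (x := x) (r := R / 2) (M := 2 * δ / k) (by positivity) (fun z hz => hb1 z (by
        rw [mem_closedBall] at *
        have := dist_triangle z x x0
        linarith))
      have d2 := cauchyE hXd (x := x) (r := R) (M := η) (by positivity) (fun z hz => hp z (by
        rw [mem_closedBall] at *
        have := dist_triangle z x x0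
        linarith))
      rw [fd_sub_id D] at d1 d2
      have e1 : c1 / k = 2 * δ / k + 2 * (2 * δ / k) / (R / 2) := by
        rw [hc1]; field_simp; ring
      have e2 : c2 * η = η + 2 * η / R := by rw [hc2]; ring
      have p1 : 0 ≤ 2 * δ / k := by positivity
      have p2 : 0 ≤ 2 * (2 * δ / k) / (R / 2) := by positivity
      have p3 : 0 ≤ 2 * η / R := by positivity
      have h1 := hest p x hx3 ε (le_min ((hb1 x hxR).trans (by linarith)) ((hp x hx3).trans (by linarith)))
        (le_min (d1.trans (by linarith)) (d2.trans (by linarith))) ((min_le_right _ _).trans hηε)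
      have h2 : ε ^ 2 ≤ c1 / k * (c2 * η) := by
        rw [sq]
        exact mul_le_mul (min_le_left _ _) (min_le_right _ _) hεp (by positivity)
      have h3 : ‖f^[p] x - x‖ ≤ n * ‖f^[p] x - x‖ := by
        have : (1 : ℝ) ≤ n := by exact_mod_cast hn
        nlinarith [norm_nonneg (f^[p] x - x)]
      calc _ ≤ C' * ε ^ 2 := h3.trans h1
        _ ≤ C' * (c1 / k * (c2 * η)) := by gcongr
        _ = _ := by ring
    obtain ⟨z, hz, hzδ⟩ := hspec
    have hfin := h3c (fun z => f^[K * p] z - z) ((D.hf.iterate _).sub differentiable_id) (fun z hz => ?_) (fun x hx => ?_) z hz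
    · linarith
    · exact (norm_sub_le _ _).trans (add_le_add (D.hN z hz _) (D.hN z hz 0))
    · have h1 := dbl D le_rfl (closedBall_subset_closedBall (by linarith) hx) hpδ K hmin
      have h3 := norm_sub_norm_le (f^[K * p] x - x) ((K : ℝ) • (f^[p] x - x)) 
      rw [norm_smul, Real.norm_natCast] at h3
      have h4 := hb2 x hx
      have hK2 : (K : ℝ) ≤ 2 * k := by rw [hk]; push_cast; linarith
      calc ‖f^[K * p] x - x‖ ≤ 3 / 2 * K * ‖f^[p] x - x‖ := by linarith
        _ ≤ 3 / 2 * (2 * k) * (C' * c1 * c2 * η / k) := by gcongr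
        _ = 3 * C' * c1 * c2 * η := by field_simp
        _ ≤ η1 := hηη
end dbl


section fin
variable {n : ℕ} {f g : En n → En n} {x0 : En n} {R N C : ℝ}

theorem det_one_eq_one (A : En 1 →L[ℂ] En 1) (h : A.det = 1) : A = 1 := by
  have h1 : LinearMap.det (A : En 1 →ₗ[ℂ] En 1) = 1 := h
  rw [← LinearMap.det_toMatrix (EuclideanSpace.basisFun (Fin 1) ℂ).toBasis, Matrix.det_fin_one, LinearMap.toMatrix_apply] at h1
  have h2 : (A (EuclideanSpace.single 0 1)) 0 = 1 := by simpa using h1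
  ext z i
  rw [apply_En A z]
  have : i = 0 := Subsingleton.elim _ _
  subst this
  simp [h2]

theorem unbdd {E : Type*} [NormedAddCommGroup E] [NormedSpace ℝ E] {w : E} (hw : w ≠ 0) {M : ℝ}
    (h : ∀ K : ℕ, ‖K • w‖ ≤ M) : False := by
  have h0 : 0 < ‖w‖ := norm_pos_iff.2 hw
  obtain ⟨K, hK⟩ := exists_nat_gt (M / ‖w‖)
  rw [div_lt_iff₀ h0] at hK
  have := h K
  rw [← Nat.cast_smul_eq_nsmul ℝ, norm_smul, Real.norm_natCast] at this
  linarith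

theorem no_dyn_one {f g : En 1 → En 1} {x0 : En 1} (D : Dyn f g x0 R N C) : False := by
  have hR := D.hR
  obtain ⟨M, hM⟩ := D.hS 0 (EuclideanSpace.single 0 1) rfl (fun _ => 1) (differentiable_const _)
  have hB : ∀ k, Bk f g k x0 = 1 := by
    intro k
    have h1 := B_mul D.hf D.hg D.hl k x0
    rw [det_one_eq_one _ (det_iter D.hf D.hd k x0), mul_one] at h1
    exact h1
  apply unbdd (w := (EuclideanSpace.single 0 1 : En 1)) (M := M) (by
    intro h
    have := congrArg (fun z : En 1 => z 0) h
    simp at this)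
  intro K
  have := hM x0 (mem_closedBall_self (by positivity)) K
  simpa [hB] using this

theorem no_dyn_fin (D : Dyn f g x0 R N C) (hn : 2 ≤ n) {p : ℕ} (hp : 0 < p)
    (hper : ∀ x ∈ closedBall x0 R, f^[p] x = x) : False := by
  have hR := D.hR
  set S : Set ℕ := Function.minimalPeriod f '' ball x0 R with hS
  have hSb : ∀ y ∈ ball x0 R, Function.minimalPeriod f y ≤ p := fun y hy =>
    Function.IsPeriodicPt.minimalPeriod_le hp (hper y (ball_subset_closedBall hy))
  have hSB : BddAbove S := ⟨p, by rintro _ ⟨y, hy, rfl⟩; exact hSb y hy⟩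
  have hSm := Nat.sSup_mem (s := S) ⟨_, x0, mem_ball_self hR, rfl⟩ hSB
  obtain ⟨x, hx, hxq⟩ := hSm
  have hmax : ∀ y ∈ ball x0 R, Function.minimalPeriod f y ≤ Function.minimalPeriod f x := by
    intro y hy
    rw [hxq]
    exact le_csSup hSB ⟨y, hy, rfl⟩
  have hpos : ∀ y ∈ ball x0 R, 0 < Function.minimalPeriod f y := fun y hy =>
    Function.IsPeriodicPt.minimalPeriod_pos hp (hper y (ball_subset_closedBall hy))
  have hq0 := hpos x hx
  have hxper := Function.isPeriodicPt_minimalPeriod f x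
  have hxne : ∀ i ∈ Finset.Ioo 0 (Function.minimalPeriod f x), f^[i] x ≠ x := by
    intro i hi
    rw [Finset.mem_Ioo] at hi
    exact Function.not_isPeriodicPt_of_pos_of_lt_minimalPeriod (by omega) hi.2
  set q := Function.minimalPeriod f x with hq
  have hnear : ∀ᶠ y in 𝓝 x, y ∈ ball x0 R ∧ ∀ i ∈ Finset.Ioo 0 q, f^[i] y ≠ y := by
    have hb0 : ∀ᶠ y in 𝓝 x, y ∈ ball x0 R := isOpen_ball.mem_nhds hx
    refine hb0.and ?_
    rw [Filter.eventually_all_finset]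
    intro i hi
    have : Continuous (f^[i]) := D.hf.continuous.iterate i
    exact (this.continuousAt.ne_iff_eventually_ne continuousAt_id).1 (hxne i hi)
  have hnear2 : ∀ᶠ y in 𝓝 x, Function.IsPeriodicPt f q y := by
    filter_upwards [hnear] with y hy
    have h1 : Function.minimalPeriod f y = q := by
      apply le_antisymm (hmax y hy.1)
      by_contra hlt
      push Not at hlt
      exact hy.2 _ (Finset.mem_Ioo.2 ⟨hpos y hy.1, hlt⟩) (Function.isPeriodicPt_minimalPeriod f y)
    rw [← h1]
    exact Function.isPeriodicPt_minimalPeriod f y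
  have hB1 : ∀ i : ℕ, Bk f g (i * q) x = 1 := by
    intro i
    have h1 : f^[i * q] =ᶠ[𝓝 x] id := by
      filter_upwards [hnear2] with y hy
      exact hy.const_mul i
    have h2 := B_mul D.hf D.hg D.hl (i * q) x
    rw [h1.fderiv_eq, fderiv_id] at h2
    exact h2
  obtain ⟨l', hl'⟩ := Module.exists_dual_forall_apply_ne_zero (K := ℂ) (M := En n)
    (fun i : Finset.Ioo 0 q => x - f^[i] x) (fun i => sub_ne_zero.2 (hxne i i.2).symm)
  set l : En n →L[ℂ] ℂ := LinearMap.toContinuousLinearMap l' with hl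
  have hll : ∀ z, l z = l' z := fun z => rfl
  have hker : LinearMap.ker l' ≠ ⊥ := LinearMap.ker_ne_bot_of_finrank_lt (by simp; omega)
  obtain ⟨v, hvk, hv0⟩ := (Submodule.ne_bot_iff _).1 hker
  have hlv : l v = 0 := by rw [hll]; exact hvk
  set h : ℂ → ℂ := fun s => ∏ i ∈ Finset.Ioo 0 q, (s - l (f^[i] x)) with hh
  have hhd : Differentiable ℂ h := by
    rw [hh]
    apply Differentiable.fun_finsetProd
    intro i _
    fun_prop
  obtain ⟨M, hM⟩ := D.hS l v hlv h hhd
  have hhx : h (l x) ≠ 0 := by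
    rw [hh]
    apply Finset.prod_ne_zero_iff.2
    intro i hi
    rw [← map_sub, hll]
    exact hl' ⟨i, hi⟩
  have hx6 : x ∈ closedBall x0 (6 * R) := closedBall_subset_closedBall (by linarith) (ball_subset_closedBall hx)
  apply unbdd (w := h (l x) • v) (M := M) (smul_ne_zero hhx hv0)
  intro K
  have hsum : ∑ j ∈ Finset.range (K * q), Bk f g (j + 1) x (h (l (f^[j + 1] x)) • v) = K • (h (l x) • v) := by
    induction K with
    | zero => simp
    | succ K ih =>
      rw [show (K + 1) * q = K * q + q by ring, Finset.sum_range_add, ih, succ_nsmul]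
      congr 1
      obtain ⟨r, hr⟩ : ∃ r, q = r + 1 := ⟨q - 1, by omega⟩
      have e1 : Finset.range q = Finset.range (r + 1) := by rw [hr]
      rw [e1, Finset.sum_range_succ, Finset.sum_eq_zero, zero_add]
      · have e2 : K * q + r + 1 = (K + 1) * q := by rw [add_assoc, ← hr]; ring
        rw [e2, hB1, (hxper.const_mul (K + 1)).eq]
        rfl
      · intro j hj
        rw [Finset.mem_range] at hj
        have e3 : f^[K * q + j + 1] x = f^[j + 1] x := by
          rw [show K * q + j + 1 = j + 1 + K * q by ring, Function.iterate_add_apply, (hxper.const_mul K).eq]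
        have e4 : h (l (f^[j + 1] x)) = 0 := by
          rw [hh]
          exact Finset.prod_eq_zero (i := j + 1) (Finset.mem_Ioo.2 ⟨by omega, by omega⟩) (sub_self _)
        rw [e3, e4, zero_smul, map_zero]
  rw [← hsum]
  exact hM x hx6 _

theorem no_dyn (D : Dyn f g x0 R N C) (hn : 1 ≤ n) : False := by
  rcases Nat.lt_or_ge n 2 with h | h
  · obtain rfl : n = 1 := by omega
    exact no_dyn_one D
  · obtain ⟨p, hp, hper⟩ := fin_order D hn
    exact no_dyn_fin D h hp hper

theorem iter_cont (m : ℕ) (x : En n) : Continuous (fun φ : AutOmega n => φ.1^[m] x) := by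
  induction m with
  | zero => exact continuous_const
  | succ m ih =>
    simp only [Function.iterate_succ_apply']
    exact continuous_subtype_val.eval ih

theorem final (n : ℕ) (hn : 1 ≤ n) :
    ∃ S : ℕ → Set ↥(AutOmega n),
      (∀ k, IsOpen (S k) ∧ Dense (S k)) ∧
      (⋂ k, S k) ⊆ {f : ↥(AutOmega n) | Expelling ⇑f.1} := by
  let T : ℕ × ℕ × ℕ → Set (AutOmega n) := fun a =>
    {φ | ∃ x ∈ ball (TopologicalSpace.denseSeq (En n) a.1) (1 / ((a.2.1 : ℝ) + 1)), ∃ m : ℕ, (a.2.2 : ℝ) < ‖φ.1^[m] x‖}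
  let e : ℕ ≃ ℕ × ℕ × ℕ := (Denumerable.eqv (ℕ × ℕ × ℕ)).symm
  refine ⟨fun k => T (e k), fun k => ⟨?_, ?_⟩, ?_⟩
  · have : T (e k) = ⋃ x ∈ ball (TopologicalSpace.denseSeq (En n) (e k).1) (1 / (((e k).2.1 : ℝ) + 1)), ⋃ m : ℕ,
        {φ | ((e k).2.2 : ℝ) < ‖φ.1^[m] x‖} := by
      ext φ
      simp only [T, Set.mem_ofPred_eq, mem_iUnion, exists_prop]
    show IsOpen (T (e k))
    rw [this]
    exact isOpen_biUnion fun x _ => isOpen_iUnion fun m => isOpen_lt continuous_const (iter_cont m x).norm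
  · intro φ
    rw [_root_.mem_closure_iff]
    intro O hO hφ
    by_contra hne
    rw [not_nonempty_iff_eq_empty] at hne
    have hr : (0 : ℝ) < 1 / (((e k).2.1 : ℝ) + 1) := by positivity
    obtain ⟨g, C, D⟩ := exists_dyn φ O hO hφ (TopologicalSpace.denseSeq (En n) (e k).1)
      ((1 / (((e k).2.1 : ℝ) + 1)) / 16) ((e k).2.2 : ℝ) (by positivity) (by
        intro ψ hψ x hx m
        by_contra hlt
        push Not at hlt
        have : ψ ∈ O ∩ T (e k) := ⟨hψ, x, closedBall_subset_ball (by linarith) hx, m, hlt⟩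
        rw [hne] at this
        exact this)
    exact no_dyn D hn
  · intro φ hφ
    rw [mem_iInter] at hφ
    have hφ' : ∀ a, φ ∈ T a := fun a => by
      have := hφ (e.symm a)
      simpa using this
    show Dense _
    have hd := dense_iInter_of_isOpen_nat (X := En n) (f := fun N : ℕ => {x | ∃ m : ℕ, (N : ℝ) < ‖φ.1^[m] x‖}) ?_ ?_
    · refine hd.mono ?_
      intro x hx hb
      rw [mem_iInter] at hx
      obtain ⟨M, hM⟩ := hb.exists_norm_le
      obtain ⟨N, hN⟩ := exists_nat_gt M
      obtain ⟨m, hm⟩ := hx N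
      have := hM _ ⟨m, rfl⟩
      linarith
    · intro N
      have : {x : En n | ∃ m : ℕ, (N : ℝ) < ‖φ.1^[m] x‖} = ⋃ m : ℕ, {x | (N : ℝ) < ‖φ.1^[m] x‖} := by
        ext x; simp
      rw [this]
      exact isOpen_iUnion fun m => isOpen_lt continuous_const (φ.1.continuous.iterate m).norm
    · intro N
      rw [Metric.dense_iff]
      intro x r hr
      obtain ⟨j, hj⟩ := exists_nat_one_div_lt (half_pos hr)
      obtain ⟨i, hi⟩ := (TopologicalSpace.denseRange_denseSeq (En n)).exists_dist_lt x (half_pos hr)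
      obtain ⟨y, hy, m, hm⟩ := hφ' (i, j, N)
      refine ⟨y, ?_, m, hm⟩
      rw [mem_ball] at *
      have := dist_triangle y (TopologicalSpace.denseSeq (En n) i) x
      rw [dist_comm x] at hi
      simp only at hy
      linarith
end fin

/-- For n ≥ 1, the set of expelling automorphisms is comeagre in Aut_{ω₀}(ℂⁿ). -/
theorem stmt_5 (n : ℕ) (hn : 1 ≤ n) :
    ∃ S : ℕ → Set ↥(AutOmega n),
      (∀ k, IsOpen (S k) ∧ Dense (S k)) ∧
      (⋂ k, S k) ⊆ {f : ↥(AutOmega n) | Expelling ⇑f.1} := by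
  exact final n hn
end
end

section
/- Let n ≥ 1. The set of expelling automorphisms is a G_δ subset of Aut(ℂⁿ), i.e., it is a countable intersection of open subsets of Aut(ℂⁿ) in the compact-open topology. -/
open Topology Filter Metric Set Function

noncomputable section

theorem aux_cont {n : ℕ} (x : En n) (k : ℕ) :
    Continuous fun f : C(En n, En n) => (⇑f)^[k] x := by
  induction k with
  | zero => simpa using continuous_const
  | succ k ih =>
    simp only [Function.iterate_succ_apply']
    exact continuous_eval.comp (continuous_id.prodMk ih)

theorem aux_unb {n : ℕ} (f : C(En n, En n)) :
    {x : En n | ¬ Bornology.IsBounded (Set.range fun k : ℕ => (⇑f)^[k] x)} =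
      ⋂ N : ℕ, ⋃ k : ℕ, {x : En n | (N : ℝ) < ‖(⇑f)^[k] x‖} := by
  ext x
  simp only [mem_setOf_eq, mem_iInter, mem_iUnion, isBounded_iff_forall_norm_le,
    forall_mem_range]
  constructor
  · intro h N
    by_contra! hc
    exact h ⟨N, hc⟩
  · rintro h ⟨C, hC⟩
    obtain ⟨N, hN⟩ := exists_nat_ge C
    obtain ⟨k, hk⟩ := h N
    linarith [hC k]

theorem aux_exp {n : ℕ} (f : C(En n, En n)) :
    Expelling ⇑f ↔ ∀ N : ℕ, ∀ U ∈ TopologicalSpace.countableBasis (En n),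
      ∃ x ∈ U, ∃ k : ℕ, (N : ℝ) < ‖(⇑f)^[k] x‖ := by
  unfold Expelling
  rw [aux_unb]
  constructor
  · intro h N U hU
    obtain ⟨x, hxU, hx⟩ := h.inter_open_nonempty U
      (TopologicalSpace.isOpen_of_mem_countableBasis hU)
      (TopologicalSpace.nonempty_of_mem_countableBasis hU)
    exact ⟨x, hxU, mem_iUnion.1 (mem_iInter.1 hx N)⟩
  · intro h
    apply dense_iInter_of_isOpen
    · intro N
      refine isOpen_iUnion fun k => ?_
      exact isOpen_lt continuous_const (f.continuous.iterate k).norm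
    · intro N
      rw [(TopologicalSpace.isBasis_countableBasis (En n)).dense_iff]
      intro U hU _
      obtain ⟨x, hxU, k, hk⟩ := h N U hU
      exact ⟨x, hxU, mem_iUnion.2 ⟨k, hk⟩⟩

/-- For n ≥ 1, the set of expelling automorphisms is a G_δ subset of Aut(ℂⁿ). -/
theorem stmt_6 (n : ℕ) (hn : 1 ≤ n) :
    IsGδ {f : ↥(AutCN n) | Expelling ⇑f.1} := by
  have key : {f : ↥(AutCN n) | Expelling ⇑f.1} =
      ⋂ N : ℕ, ⋂ U ∈ TopologicalSpace.countableBasis (En n),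
        {f : ↥(AutCN n) | ∃ x ∈ U, ∃ k : ℕ, (N : ℝ) < ‖(⇑f.1)^[k] x‖} := by
    ext f
    simp only [mem_setOf_eq, mem_iInter]
    exact aux_exp f.1
  rw [key]
  refine IsGδ.iInter fun N => IsGδ.biInter
    (TopologicalSpace.countable_countableBasis (En n)) fun U _ => IsOpen.isGδ ?_
  have : {f : ↥(AutCN n) | ∃ x ∈ U, ∃ k : ℕ, (N : ℝ) < ‖(⇑f.1)^[k] x‖} =
      ⋃ x ∈ U, ⋃ k : ℕ, {f : ↥(AutCN n) | (N : ℝ) < ‖(⇑f.1)^[k] x‖} := by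
    ext f
    simp
  rw [this]
  exact isOpen_biUnion fun x _ => isOpen_iUnion fun k =>
    isOpen_lt continuous_const ((aux_cont x k).comp continuous_subtype_val).norm
end
end

section
/- Let n ≥ 1, let f be a volume-preserving holomorphic automorphism of ℂⁿ, and let A ⊂ ℂⁿ be a bounded open set with f(A) ⊂ A. Then f(A) = A. -/
open Topology Filter Metric Set Function

noncomputable section

open MeasureTheory in
lemma vol_image_aux {n : ℕ} (f : En n → En n) (hf : Differentiable ℂ f) (hinj : Injective f)
    (hv : IsVolPres f) (μ : Measure (En n)) [μ.IsAddHaarMeasure]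
    (s : Set (En n)) (hs : MeasurableSet s) : μ (f '' s) = μ s := by
  have hd : ∀ x ∈ s, HasFDerivWithinAt f ((fderiv ℂ f x).restrictScalars ℝ) s x := fun x _ =>
    ((hf x).hasFDerivAt.restrictScalars ℝ).hasFDerivWithinAt
  rw [← lintegral_abs_det_fderiv_eq_addHaar_image μ hs hd hinj.injOn]
  have : ∀ x, ((fderiv ℂ f x).restrictScalars ℝ).det = 1 := by
    intro x
    have h1 : ((fderiv ℂ f x).restrictScalars ℝ).det = Algebra.norm ℝ ((fderiv ℂ f x).det) :=
      LinearMap.det_restrictScalars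
    rw [h1, hv x, map_one]
  simp [this]

open MeasureTheory in
/-- If f is a volume-preserving holomorphic automorphism of ℂⁿ (n ≥ 1) and
A ⊂ ℂⁿ is a bounded open set with f(A) ⊆ A, then f(A) = A. -/
theorem stmt_8 (n : ℕ) (hn : 1 ≤ n) (f : En n → En n)
    (hf : IsHoloAut f) (hv : IsVolPres f)
    (A : Set (En n)) (hAo : IsOpen A) (hAb : Bornology.IsBounded A)
    (hinv : f '' A ⊆ A) :
    f '' A = A := by
  obtain ⟨hfd, g, hgd, hgf, hfg⟩ := hf
  let μ : Measure (En n) := Measure.addHaar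
  have him := vol_image_aux f hfd hgf.injective hv μ
  have hmp : MeasurePreserving f μ μ := by
    refine ⟨hfd.continuous.measurable, ?_⟩
    ext s hs
    rw [Measure.map_apply hfd.continuous.measurable hs,
      ← him _ (hfd.continuous.measurable hs), image_preimage_eq _ hfg.surjective]
  have hfin : μ A ≠ ⊤ := hAb.measure_lt_top.ne
  have hfA : IsOpen (f '' A) := by
    rw [image_eq_preimage_of_inverse hgf hfg]
    exact hAo.preimage hgd.continuous
  have hnull : μ (A \ f '' A) = 0 := by
    rw [measure_sdiff hinv hfA.measurableSet.nullMeasurableSet (by rwa [him _ hAo.measurableSet]),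
      him _ hAo.measurableSet, tsub_self]
  have hsub : A ⊆ closure (f '' A) := by
    have ho : IsOpen (A \ closure (f '' A)) := hAo.sdiff isClosed_closure
    have h0 : μ (A \ closure (f '' A)) = 0 :=
      measure_mono_null (diff_subset_diff_right subset_closure) hnull
    exact diff_eq_empty.1 ((ho.measure_eq_zero_iff μ).1 h0)
  have hgC : MapsTo g (closure A) (closure A) := by
    intro y hy
    have hy' : y ∈ closure (f '' A) := closure_minimal hsub isClosed_closure hy
    have := image_closure_subset_closure_image hgd.continuous (mem_image_of_mem g hy')
    rwa [image_image, show (fun x => g (f x)) = id from funext hgf, image_id] at this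
  have hae : (f ⁻¹' A : Set (En n)) =ᵐ[μ] A := by
    symm
    refine ae_eq_of_subset_of_measure_ge (image_subset_iff.1 hinv) ?_
      hAo.measurableSet.nullMeasurableSet ?_
    · rw [hmp.measure_preimage hAo.measurableSet.nullMeasurableSet]
    · rwa [hmp.measure_preimage hAo.measurableSet.nullMeasurableSet]
  have hmpA : MeasurePreserving f (μ.restrict A) (μ.restrict A) := by
    have := hmp.restrict_preimage hAo.measurableSet
    rwa [Measure.restrict_congr_set hae] at this
  haveI : IsFiniteMeasure (μ.restrict A) := ⟨by simpa using hfin.lt_top⟩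
  refine hinv.antisymm fun x hx => ?_
  obtain ⟨r, hr, hrA⟩ := Metric.isOpen_iff.1 hAo x hx
  obtain ⟨R, hR⟩ := Metric.isBounded_iff.1 hAb.closure
  have hR0 : 0 ≤ R := by simpa using hR (subset_closure hx) (subset_closure hx)
  obtain ⟨ε, hε, hεr⟩ : ∃ ε > 0, R / r * ε + ε < r := by
    refine ⟨r / (R / r + 2), by positivity, ?_⟩
    have : 0 ≤ R / r := by positivity
    rw [show R / r * (r / (R / r + 2)) + r / (R / r + 2) = r * ((R / r + 1) / (R / r + 2)) by ring]
    have : (R / r + 1) / (R / r + 2) < 1 := by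
      rw [div_lt_one (by positivity)]; linarith
    nlinarith
  have hεr' : ε ≤ r := by
    have : 0 ≤ R / r * ε := by positivity
    linarith
  have hpos : (μ.restrict A) (ball x ε) ≠ 0 := by
    rw [Measure.restrict_apply measurableSet_ball,
      inter_eq_left.2 ((ball_subset_ball hεr').trans hrA)]
    exact (measure_ball_pos μ x hε).ne'
  obtain ⟨z, hz, m, hm, hmz⟩ :=
    hmpA.exists_mem_iterate_mem measurableSet_ball.nullMeasurableSet hpos
  have hgm : ∀ y, g^[m] (f^[m] y) = y := hgf.iterate m
  have hfm : ∀ y, f^[m] (g^[m] y) = y := hfg.iterate m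
  have hdm : Differentiable ℂ g^[m] := hgd.iterate m
  have hC := hgC.iterate m
  have hS := Complex.dist_le_div_mul_dist_of_mapsTo_ball (f := g^[m]) (c := x) (R₁ := r) (R₂ := R)
    (z := f^[m] z) hdm.differentiableOn
    (fun y hy => hR (hC (subset_closure (hrA hy))) (hC (subset_closure hx)))
    (ball_subset_ball hεr' hmz)
  rw [hgm] at hS
  have hw : g^[m] x ∈ A := by
    apply hrA
    rw [mem_ball]
    have h1 : R / r * dist (f^[m] z) x ≤ R / r * ε :=
      mul_le_mul_of_nonneg_left (mem_ball.1 hmz).le (by positivity)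
    have h2 := dist_triangle_left (g^[m] x) x z
    have h3 := mem_ball.1 hz
    linarith
  obtain ⟨k, rfl⟩ := Nat.exists_eq_succ_of_ne_zero hm
  refine ⟨f^[k] (g^[k+1] x), (mapsTo_iff_image_subset.2 hinv).iterate k hw, ?_⟩
  rw [← Function.iterate_succ_apply' f]
  exact hfm x
end
end

section
/- Let Ω ⊂ ℂⁿ be a bounded open set. The set Aut_ω(Ω) of volume-preserving holomorphic automorphisms of Ω, i.e., bijective holomorphic maps g : Ω → Ω with holomorphic inverse and det Dg(z) = 1 for all z ∈ Ω, is compact in the topology of locally uniform convergence on the space of continuous maps Ω → ℂⁿ: every sequence in Aut_ω(Ω) has a subsequence converging uniformly on compact subsets of Ω to an element of Aut_ω(Ω). -/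
open Topology Filter Metric Set Function

noncomputable section

/-- A volume-preserving holomorphic automorphism of an open set Ω ⊂ ℂⁿ: a bijection of Ω that is
holomorphic on Ω with holomorphic inverse, whose derivative has determinant 1 on Ω. -/
def IsVolAutOn {n : ℕ} (Ω : Set (En n)) (g : En n → En n) : Prop :=
  Set.BijOn g Ω Ω ∧ DifferentiableOn ℂ g Ω ∧
  (∃ h : En n → En n, DifferentiableOn ℂ h Ω ∧ Set.InvOn h g Ω Ω) ∧
  ∀ z ∈ Ω, (fderiv ℂ g z).det = 1

lemma aux_cauchy {n : ℕ} {f : En n → En n} {c : En n} {r M : ℝ} (hr : 0 < r)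
    (hd : DifferentiableOn ℂ f (ball c r)) (hM : ∀ x ∈ ball c r, ‖f x‖ ≤ M) :
    ‖fderiv ℂ f c‖ ≤ 2 * M / r := by
  refine Complex.norm_fderiv_le_div_of_mapsTo_ball hd (fun x hx => ?_) hr
  rw [mem_closedBall, dist_eq_norm]
  have := norm_sub_le (f x) (f c)
  linarith [hM x hx, hM c (mem_ball_self hr)]

lemma aux_ball {n : ℕ} {Ω : Set (En n)} (hΩo : IsOpen Ω) {z : En n} (hz : z ∈ Ω) :
    ∃ r > 0, closedBall z (2 * r) ⊆ Ω := by
  obtain ⟨e, he, h⟩ := Metric.nhds_basis_closedBall.mem_iff.1 (hΩo.mem_nhds hz)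
  exact ⟨e / 2, by positivity, by rwa [mul_div_cancel₀ _ two_ne_zero]⟩

lemma aux_ball_sub {n : ℕ} {x z : En n} {r : ℝ} (hx : x ∈ ball z r) :
    ball x r ⊆ closedBall z (2 * r) := by
  intro y hy
  rw [mem_ball] at hx hy
  rw [mem_closedBall]
  linarith [dist_triangle y x z]

lemma aux_cont_s9 {n : ℕ} {Ω : Set (En n)} (hΩo : IsOpen Ω) {f : En n → En n}
    (hf : DifferentiableOn ℂ f Ω) : ContinuousOn (fderiv ℂ f) Ω := by
  intro z hz
  apply ContinuousAt.continuousWithinAt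
  obtain ⟨r, hr, hsub⟩ := aux_ball hΩo hz
  have huc := (isCompact_closedBall z (2 * r)).uniformContinuousOn_of_continuous
    (hf.continuousOn.mono hsub)
  rw [Metric.uniformContinuousOn_iff] at huc
  rw [Metric.continuousAt_iff]
  intro ε hε
  obtain ⟨δ, hδ, H⟩ := huc (ε * r / 4) (by positivity)
  refine ⟨min δ r, by positivity, fun {x} hx => ?_⟩
  have hxδ : dist x z < δ := lt_of_lt_of_le hx (min_le_left _ _)
  have hxr : dist x z < r := lt_of_lt_of_le hx (min_le_right _ _)
  have hmem : ∀ w ∈ ball z r, w + (x - z) ∈ closedBall z (2 * r) := by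
    intro w hw
    rw [mem_ball, dist_eq_norm] at hw
    rw [dist_eq_norm] at hxr
    rw [mem_closedBall, dist_eq_norm]
    have : w + (x - z) - z = (w - z) + (x - z) := by abel
    rw [this]
    linarith [norm_add_le (w - z) (x - z)]
  have hmem' : ∀ w ∈ ball z r, w ∈ closedBall z (2 * r) := by
    intro w hw
    rw [mem_ball] at hw
    rw [mem_closedBall]
    linarith
  have hd1 : DifferentiableOn ℂ (fun w => f (w + (x - z))) (ball z r) :=
    hf.comp (by fun_prop) (fun w hw => hsub (hmem w hw))
  have hd2 : DifferentiableOn ℂ f (ball z r) := hf.mono (fun w hw => hsub (hmem' w hw))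
  have hn : ball z r ∈ 𝓝 z := ball_mem_nhds z hr
  have key := aux_cauchy (f := fun w => f (w + (x - z)) - f w) (M := ε * r / 4) hr
    (hd1.sub hd2) (fun w hw => by
      rw [← dist_eq_norm]
      refine (H _ (hmem w hw) _ (hmem' w hw) ?_).le
      rwa [dist_eq_norm, add_sub_cancel_left, ← dist_eq_norm])
  rw [fderiv_fun_sub (hd1.differentiableAt hn) (hd2.differentiableAt hn),
    fderiv_comp_add_right, add_sub_cancel, ← dist_eq_norm] at key
  have : 2 * (ε * r / 4) / r = ε / 2 := by field_simp; ring
  linarith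

lemma aux_weier {n : ℕ} {Ω : Set (En n)} (hΩo : IsOpen Ω) {F : ℕ → En n → En n} {h : En n → En n}
    (hF : ∀ k, DifferentiableOn ℂ (F k) Ω) (hT : TendstoLocallyUniformlyOn F h atTop Ω) :
    DifferentiableOn ℂ h Ω ∧
      TendstoLocallyUniformlyOn (fun k => fderiv ℂ (F k)) (fderiv ℂ h) atTop Ω := by
  have hUC : ∀ z ∈ Ω, ∃ r > 0, ball z r ⊆ Ω ∧
      UniformCauchySeqOn (fun k => fderiv ℂ (F k)) atTop (ball z r) := by
    intro z hz
    obtain ⟨r, hr, hsub⟩ := aux_ball hΩo hz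
    refine ⟨r, hr, fun w hw => hsub (ball_subset_closedBall
      (ball_subset_ball (by linarith) hw)), ?_⟩
    have h1 := ((tendstoLocallyUniformlyOn_iff_forall_isCompact hΩo).1 hT _ hsub
      (isCompact_closedBall z (2 * r))).uniformCauchySeqOn
    rw [Metric.uniformCauchySeqOn_iff] at h1 ⊢
    intro ε hε
    obtain ⟨N, hN⟩ := h1 (ε * r / 4) (by positivity)
    refine ⟨N, fun a ha b hb x hx => ?_⟩
    have hs := (aux_ball_sub hx).trans hsub
    have hn : ball x r ∈ 𝓝 x := ball_mem_nhds x hr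
    have key := aux_cauchy (f := fun w => F a w - F b w) (M := ε * r / 4) hr
      (((hF a).mono hs).sub ((hF b).mono hs)) (fun w hw => by
        rw [← dist_eq_norm]
        exact (hN a ha b hb w (aux_ball_sub hx hw)).le)
    rw [fderiv_fun_sub (((hF a).mono hs).differentiableAt hn)
      (((hF b).mono hs).differentiableAt hn), ← dist_eq_norm] at key
    have : 2 * (ε * r / 4) / r = ε / 2 := by field_simp; ring
    linarith
  have hex : ∀ z, ∃ L, z ∈ Ω → Tendsto (fun k => fderiv ℂ (F k) z) atTop (𝓝 L) := by
    intro z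
    by_cases hz : z ∈ Ω
    · obtain ⟨r, hr, -, hu⟩ := hUC z hz
      obtain ⟨L, hL⟩ := cauchySeq_tendsto_of_complete (hu.cauchySeq (mem_ball_self hr))
      exact ⟨L, fun _ => hL⟩
    · exact ⟨0, fun h => absurd h hz⟩
  choose g' hg' using hex
  have hT' : TendstoLocallyUniformlyOn (fun k => fderiv ℂ (F k)) g' atTop Ω := by
    intro u hu z hz
    obtain ⟨r, hr, hsub, huc⟩ := hUC z hz
    have := huc.tendstoUniformlyOn_of_tendsto (fun x hx => hg' x (hsub hx))
    exact ⟨ball z r, mem_nhdsWithin_of_mem_nhds (ball_mem_nhds z hr), this u hu⟩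
  have hder : ∀ x ∈ Ω, HasFDerivAt h (g' x) x := fun x hx =>
    hasFDerivAt_of_tendstoLocallyUniformlyOn hΩo hT'
      (fun k y hy => ((hF k).differentiableAt (hΩo.mem_nhds hy)).hasFDerivAt)
      (fun y hy => hT.tendsto_at hy) hx
  exact ⟨fun x hx => (hder x hx).differentiableAt.differentiableWithinAt,
    hT'.congr_right (fun x hx => (hder x hx).fderiv.symm)⟩

lemma aux_montel {n : ℕ} {Ω : Set (En n)} (hΩo : IsOpen Ω) {F : ℕ → En n → En n} {M : ℝ}
    (hF : ∀ k, DifferentiableOn ℂ (F k) Ω) (hM : ∀ k, ∀ x ∈ Ω, ‖F k x‖ ≤ M) :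
    ∃ φ : ℕ → ℕ, StrictMono φ ∧ ∃ h : En n → En n,
      TendstoLocallyUniformlyOn (fun k => F (φ k)) h atTop Ω := by
  have : LocallyCompactSpace Ω := hΩo.locallyCompactSpace
  let G : ℕ → C(Ω, En n) := fun k => ⟨Ω.domRestrict (F k), (hF k).continuousOn.domRestrict⟩
  have heq : Equicontinuous (fun (i : range G) (x : Ω) => (i : C(Ω, En n)) x) := by
    rintro ⟨z, hz⟩
    rw [Metric.equicontinuousAt_iff]
    intro ε hε
    obtain ⟨r, hr, hsub⟩ := aux_ball hΩo hz
    have hM0 : 0 ≤ M := (norm_nonneg _).trans (hM 0 z hz)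
    refine ⟨min r (ε * r / (2 * M + 1)), by positivity, ?_⟩
    rintro ⟨x, hx⟩ hxz ⟨_, ⟨k, rfl⟩⟩
    rw [Subtype.dist_eq] at hxz
    have hxr : dist x z < r := lt_of_lt_of_le hxz (min_le_left _ _)
    have hxe : dist x z < ε * r / (2 * M + 1) := lt_of_lt_of_le hxz (min_le_right _ _)
    have hs : ball z r ⊆ Ω := (aux_ball_sub (mem_ball_self hr)).trans hsub
    have := Complex.dist_le_div_mul_dist_of_mapsTo_ball (R₂ := 2 * M) ((hF k).mono hs)
      (fun w hw => by
        rw [mem_closedBall, dist_eq_norm]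
        linarith [norm_sub_le (F k w) (F k z), hM k w (hs hw), hM k z hz]) (z := x) hxr
    change dist (F k z) (F k x) < ε
    rw [dist_comm]
    refine this.trans_lt ?_
    rw [lt_div_iff₀ (by positivity)] at hxe
    rw [div_mul_eq_mul_div, div_lt_iff₀ hr]
    nlinarith [dist_nonneg (x := x) (y := z)]
  have : T2Space (UniformOnFun Ω (En n) {K : Set Ω | IsCompact K}) :=
    UniformOnFun.t2Space_of_covering (eq_univ_iff_forall.mpr
      (fun x => mem_sUnion_of_mem (mem_singleton x) isCompact_singleton))
  have hcl : IsClosedEmbedding (UniformOnFun.ofFun {K : Set Ω | IsCompact K} ∘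
      (fun (f : C(Ω, En n)) (x : Ω) => f x)) :=
    ContinuousMap.isUniformEmbedding_toUniformOnFunIsCompact.isClosedEmbedding
  have hcomp : IsCompact (closure (range G)) :=
    ArzelaAscoli.isCompact_closure_of_isClosedEmbedding (fun K hK => hK) hcl
      (fun K _ => heq.equicontinuousOn K)
      (fun K _ x _ => ⟨closedBall 0 M, isCompact_closedBall 0 M, by
        rintro _ ⟨k, rfl⟩
        rw [mem_closedBall_zero_iff]
        exact hM k x x.2⟩)
  obtain ⟨h, -, φ, hφ, hT⟩ := hcomp.tendsto_subseq (x := G) (fun k => subset_closure ⟨k, rfl⟩)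
  classical
  refine ⟨φ, hφ, fun x => if hx : x ∈ Ω then h ⟨x, hx⟩ else 0, ?_⟩
  rw [ContinuousMap.tendsto_iff_tendstoLocallyUniformly] at hT
  rw [tendstoLocallyUniformlyOn_iff_tendstoLocallyUniformly_comp_coe]
  convert hT using 1
  · rfl
  · funext x
    simp

lemma aux_limit {n : ℕ} {Ω : Set (En n)} (hΩo : IsOpen Ω) {F : ℕ → En n → En n} {h : En n → En n}
    (hF : ∀ k, IsVolAutOn Ω (F k)) (hT : TendstoLocallyUniformlyOn F h atTop Ω) :
    DifferentiableOn ℂ h Ω ∧ MapsTo h Ω Ω ∧ ∀ z ∈ Ω, (fderiv ℂ h z).det = 1 := by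
  obtain ⟨hd, hT'⟩ := aux_weier hΩo (fun k => (hF k).2.1) hT
  have hdet : ∀ z ∈ Ω, (fderiv ℂ h z).det = 1 := by
    intro z hz
    have h1 := (ContinuousLinearMap.continuous_det.tendsto (fderiv ℂ h z)).comp
      (hT'.tendsto_at hz)
    refine tendsto_nhds_unique h1 ?_
    refine tendsto_const_nhds.congr (fun k => ?_)
    exact ((hF k).2.2.2 z hz).symm
  refine ⟨hd, fun z hz => ?_, hdet⟩
  rcases subsingleton_or_nontrivial (En n) with hsing | hnt
  · rwa [Subsingleton.elim (h z) z]
  have hne : (fderiv ℂ h z).det ≠ 0 := by rw [hdet z hz]; exact one_ne_zero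
  set A := (fderiv ℂ h z).toContinuousLinearEquivOfDetNeZero hne with hA
  have hAc : (A : En n →L[ℂ] En n) = fderiv ℂ h z := by simp [hA]
  set N := ‖(A.symm : En n →L[ℂ] En n)‖₊ with hN
  have hNpos : 0 < N := A.nnnorm_symm_pos
  have hc : (0 : ℝ) < (N : ℝ)⁻¹ / 2 := by positivity
  have hc0 := aux_cont_s9 hΩo hd
  have e1 : ∀ᶠ y in 𝓝 z, dist (fderiv ℂ h y) (fderiv ℂ h z) < (N : ℝ)⁻¹ / 2 / 2 :=
    (Metric.tendsto_nhds.1 (hc0.continuousAt (hΩo.mem_nhds hz))) _ (by positivity)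
  obtain ⟨t, ht, e2⟩ := Metric.tendstoLocallyUniformlyOn_iff.1 hT' ((N : ℝ)⁻¹ / 2 / 2)
    (by positivity) z hz
  rw [hΩo.nhdsWithin_eq hz] at ht
  obtain ⟨r, hr, hsub⟩ := Metric.nhds_basis_closedBall.mem_iff.1
    (inter_mem (inter_mem ht (hΩo.mem_nhds hz)) e1)
  have e3 : ∀ᶠ k in atTop, dist (F k z) (h z) < (N : ℝ)⁻¹ / 2 * r :=
    (Metric.tendsto_nhds.1 (hT.tendsto_at hz)) _ (by positivity)
  obtain ⟨k, hk2, hk3⟩ := (e2.and e3).exists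
  have happ : ApproximatesLinearOn (F k) (A : En n →L[ℂ] En n) (closedBall z r) (N⁻¹ / 2) := by
    intro x hx y hy
    refine (convex_closedBall z r).norm_image_sub_le_of_norm_fderiv_le' (𝕜 := ℂ)
      (fun w hw => (hF k).2.1.differentiableAt (hΩo.mem_nhds (hsub hw).1.2))
      (fun w hw => ?_) hy hx
    rw [hAc, ← dist_eq_norm]
    have a1 := hk2 w (hsub hw).1.1
    have a2 : dist (fderiv ℂ h w) (fderiv ℂ h z) < (N : ℝ)⁻¹ / 2 / 2 := (hsub hw).2
    have a3 := dist_triangle (fderiv ℂ (F k) w) (fderiv ℂ h w) (fderiv ℂ h z)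
    rw [dist_comm] at a1
    push_cast
    linarith
  have hsurj := happ.surjOn_closedBall_of_nonlinearRightInverse A.toNonlinearRightInverse hr.le
    Subset.rfl
  have hmem : h z ∈ closedBall (F k z)
      ((((A.toNonlinearRightInverse).nnnorm : ℝ)⁻¹ - ((N⁻¹ / 2 : NNReal) : ℝ)) * r) := by
    rw [mem_closedBall, dist_comm]
    have : (A.toNonlinearRightInverse).nnnorm = N := rfl
    rw [this]
    push_cast
    have : (N : ℝ)⁻¹ - (N : ℝ)⁻¹ / 2 = (N : ℝ)⁻¹ / 2 := by ring
    rw [this]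
    exact hk3.le
  obtain ⟨x, hx, hxe⟩ := hsurj hmem
  rw [← hxe]
  exact (hF k).1.mapsTo (hsub hx).1.2

lemma aux_inv {n : ℕ} {Ω : Set (En n)} (hΩo : IsOpen Ω) {f : En n → En n}
    (hf : IsVolAutOn Ω f) : ∃ g, IsVolAutOn Ω g ∧ InvOn g f Ω Ω := by
  obtain ⟨hb, hd, ⟨g, hgd, hinv⟩, hdet⟩ := hf
  have hmaps : MapsTo g Ω Ω := by
    intro y hy
    obtain ⟨x, hx, rfl⟩ := hb.surjOn hy
    rwa [hinv.1 hx]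
  refine ⟨g, ⟨hinv.symm.bijOn hmaps hb.mapsTo, hgd, ⟨f, hd, hinv.symm⟩, fun z hz => ?_⟩, hinv⟩
  have hfd := hd.differentiableAt (hΩo.mem_nhds (hmaps hz))
  have hgd' := hgd.differentiableAt (hΩo.mem_nhds hz)
  have h1 : HasFDerivAt (f ∘ g) ((fderiv ℂ f (g z)).comp (fderiv ℂ g z)) z :=
    hfd.hasFDerivAt.comp z hgd'.hasFDerivAt
  have h2 : HasFDerivAt (f ∘ g) (ContinuousLinearMap.id ℂ (En n)) z :=
    (hasFDerivAt_id z).congr_of_eventuallyEq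
      (eventually_of_mem (hΩo.mem_nhds hz) (fun y hy => hinv.2 hy))
  have h3 := congrArg ContinuousLinearMap.det (h1.unique h2)
  have h4 : ((fderiv ℂ f (g z)).comp (fderiv ℂ g z)).det
      = (fderiv ℂ f (g z)).det * (fderiv ℂ g z).det := by
    simp only [ContinuousLinearMap.det, ContinuousLinearMap.toLinearMap_comp, LinearMap.det_comp]
  rw [h4, hdet _ (hmaps hz), one_mul] at h3
  rw [h3]
  simp [ContinuousLinearMap.det]

lemma aux_left {n : ℕ} {Ω : Set (En n)} (hΩo : IsOpen Ω) {F G : ℕ → En n → En n}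
    {f g : En n → En n} (hF : TendstoLocallyUniformlyOn F f atTop Ω)
    (hG : TendstoLocallyUniformlyOn G g atTop Ω) (hFm : ∀ k, MapsTo (F k) Ω Ω)
    (hf : MapsTo f Ω Ω) (hg : ContinuousOn g Ω)
    (hinv : ∀ k, LeftInvOn (G k) (F k) Ω) : LeftInvOn g f Ω := by
  intro z hz
  have hFz := hF.tendsto_at hz
  have h1 : Tendsto (fun k => G k (F k z)) atTop (𝓝 (g (f z))) :=
    hG.tendsto_comp (hg _ (hf hz)) (hf hz)
      (tendsto_nhdsWithin_iff.2 ⟨hFz, Eventually.of_forall fun k => hFm k hz⟩)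
  refine tendsto_nhds_unique h1 (tendsto_const_nhds.congr fun k => (hinv k hz).symm)

/-- For a bounded open set Ω ⊂ ℂⁿ, the set Aut_ω(Ω) of volume-preserving
holomorphic automorphisms of Ω is compact in the topology of locally uniform convergence:
every sequence in Aut_ω(Ω) has a subsequence converging uniformly on compact subsets of Ω
to an element of Aut_ω(Ω). -/
theorem stmt_9 (n : ℕ) (Ω : Set (En n)) (hΩo : IsOpen Ω) (hΩb : Bornology.IsBounded Ω)
    (g : ℕ → En n → En n) (hg : ∀ k, IsVolAutOn Ω (g k)) :
    ∃ φ : ℕ → ℕ, StrictMono φ ∧ ∃ h : En n → En n, IsVolAutOn Ω h ∧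
      ∀ K : Set (En n), K ⊆ Ω → IsCompact K →
        TendstoUniformlyOn (fun k => g (φ k)) h atTop K := by
  obtain ⟨M, hM⟩ := hΩb.exists_norm_le
  obtain ⟨φ, hφ, h, hh⟩ := aux_montel hΩo (F := g) (M := M) (fun k => (hg k).2.1)
    (fun k x hx => hM _ ((hg k).1.mapsTo hx))
  choose G hG hGi using fun k => aux_inv hΩo (hg k)
  obtain ⟨ψ, hψ, p, hp⟩ := aux_montel hΩo (F := fun k => G (φ k)) (M := M)
    (fun k => (hG _).2.1) (fun k x hx => hM _ ((hG _).1.mapsTo hx))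
  have hh' : TendstoLocallyUniformlyOn (fun k => g (φ (ψ k))) h atTop Ω := by
    intro u hu x hx
    obtain ⟨t, ht, H⟩ := hh u hu x hx
    exact ⟨t, ht, hψ.tendsto_atTop.eventually H⟩
  obtain ⟨hd, hm, hdet⟩ := aux_limit hΩo (fun k => hg (φ (ψ k))) hh'
  obtain ⟨pd, pm, -⟩ := aux_limit hΩo (fun k => hG (φ (ψ k))) hp
  have hinv : InvOn p h Ω Ω :=
    ⟨aux_left hΩo hh' hp (fun k => (hg _).1.mapsTo) hm pd.continuousOn (fun k => (hGi _).1),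
     aux_left hΩo hp hh' (fun k => (hG _).1.mapsTo) pm hd.continuousOn (fun k => (hGi _).2)⟩
  refine ⟨φ ∘ ψ, hφ.comp hψ, h, ⟨hinv.bijOn hm pm, hd, ⟨p, pd, hinv⟩, hdet⟩, fun K hK hKc => ?_⟩
  exact (tendstoLocallyUniformlyOn_iff_forall_isCompact hΩo).1 hh' K hK hKc
end
end

section
/- Let n ≥ 2, let x₁, …, x_m be distinct points of ℂⁿ, and for each j = 1, …, m let A_j be an n×n complex matrix with trace zero. Then there exists a holomorphic (entire) map v : ℂⁿ → ℂⁿ which is divergence-free, i.e., the trace of its complex derivative Dv(z) is 0 for every z ∈ ℂⁿ, and which satisfies v(x_j) = 0 and Dv(x_j) = A_j for j = 1, …, m. -/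
open Topology Filter Metric Set Function

noncomputable section

/-- the basic divergence-free field attached to a function and a linear map -/
def fieldV {n : ℕ} (φ : En n → ℂ) (L : En n →L[ℂ] En n) (p : En n) (z : En n) : En n :=
  φ z • L (z - p) + (n : ℂ)⁻¹ •
    ((fderiv ℂ φ z (z - p)) • L (z - p) - (fderiv ℂ φ z (L (z - p))) • (z - p))

theorem fieldV_hasFDerivAt {n : ℕ} (φ : En n → ℂ) (hφ : ContDiff ℂ 2 φ)
    (L : En n →L[ℂ] En n) (p z : En n) :
    HasFDerivAt (fieldV φ L p)
      ((φ z • L + (fderiv ℂ φ z).smulRight (L (z - p))) + (n : ℂ)⁻¹ •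
        (((fderiv ℂ φ z (z - p)) • L +
          ((fderiv ℂ (fderiv ℂ φ) z).flip (z - p) + fderiv ℂ φ z).smulRight (L (z - p))) -
        ((fderiv ℂ φ z (L (z - p))) • ContinuousLinearMap.id ℂ (En n) +
          ((fderiv ℂ (fderiv ℂ φ) z).flip (L (z - p)) + (fderiv ℂ φ z).comp L).smulRight
            (z - p)))) z := by
  have h1 : HasFDerivAt φ (fderiv ℂ φ z) z :=
    ((hφ.differentiable (by norm_num)) z).hasFDerivAt
  have h2 : HasFDerivAt (fderiv ℂ φ) (fderiv ℂ (fderiv ℂ φ) z) z :=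
    (((hφ.fderiv_right (m := 1) (by norm_num)).differentiable (by norm_num)) z).hasFDerivAt
  have hw : HasFDerivAt (fun z : En n => z - p) (ContinuousLinearMap.id ℂ (En n)) z :=
    (hasFDerivAt_id z).sub_const p
  have hL : HasFDerivAt (fun z : En n => L (z - p)) L z := by
    have := L.hasFDerivAt.comp z hw
    rwa [ContinuousLinearMap.comp_id] at this
  have h3 := h2.clm_apply hw
  have h4 := h2.clm_apply hL
  have h5 := (h1.fun_smul hL).fun_add
    (((h3.fun_smul hL).fun_sub (h4.fun_smul hw)).fun_const_smul (n : ℂ)⁻¹)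
  have e1 : ∀ a : En n, (fderiv ℂ φ z).comp (ContinuousLinearMap.id ℂ (En n)) +
      (fderiv ℂ (fderiv ℂ φ) z).flip a = (fderiv ℂ (fderiv ℂ φ) z).flip a + fderiv ℂ φ z := by
    intro a
    rw [ContinuousLinearMap.comp_id, add_comm]
  rw [e1, add_comm ((fderiv ℂ φ z).comp L)] at h5
  exact h5

theorem trace_smulRight_aux {n : ℕ} (f : En n →L[ℂ] ℂ) (w : En n) :
    LinearMap.trace ℂ (En n) ((f.smulRight w : En n →L[ℂ] En n) : En n →ₗ[ℂ] En n) = f w := by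
  have := LinearMap.trace_smulRight (f : En n →ₗ[ℂ] ℂ) w
  simpa using this

theorem fieldV_div {n : ℕ} (hn : n ≠ 0) (φ : En n → ℂ) (hφ : ContDiff ℂ 2 φ)
    (L : En n →L[ℂ] En n) (hL : LinearMap.trace ℂ (En n) (L : En n →ₗ[ℂ] En n) = 0)
    (p z : En n) :
    LinearMap.trace ℂ (En n) ((fderiv ℂ (fieldV φ L p) z : En n →ₗ[ℂ] En n)) = 0 := by
  rw [(fieldV_hasFDerivAt φ hφ L p z).fderiv]
  have hs : fderiv ℂ (fderiv ℂ φ) z (L (z - p)) (z - p)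
      = fderiv ℂ (fderiv ℂ φ) z (z - p) (L (z - p)) :=
    (hφ.contDiffAt.isSymmSndFDerivAt (by simp)) _ _
  have hid : LinearMap.trace ℂ (En n)
      ((ContinuousLinearMap.id ℂ (En n) : En n →L[ℂ] En n) : En n →ₗ[ℂ] En n) = n := by
    have := LinearMap.trace_id ℂ (En n)
    simpa using this
  have hn' : (n : ℂ) ≠ 0 := by exact_mod_cast hn
  generalize z - p = w at *
  simp only [ContinuousLinearMap.toLinearMap_add, ContinuousLinearMap.toLinearMap_sub,
    ContinuousLinearMap.toLinearMap_smul, map_add, map_sub, map_smul, trace_smulRight_aux,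
    hL, hid, smul_eq_mul, add_apply, ContinuousLinearMap.flip_apply, hs,
    ContinuousLinearMap.comp_apply]
  field_simp
  ring

theorem cube_vanish {n : ℕ} (P : En n → ℂ) (hP : ContDiff ℂ 2 P) (z : En n) (h0 : P z = 0) :
    fderiv ℂ (fun y => P y ^ 3) z = 0 ∧ fderiv ℂ (fderiv ℂ (fun y => P y ^ 3)) z = 0 := by
  have h1 : ∀ y, HasFDerivAt P (fderiv ℂ P y) y := fun y =>
    ((hP.differentiable (by norm_num)) y).hasFDerivAt
  have h2 : HasFDerivAt (fderiv ℂ P) (fderiv ℂ (fderiv ℂ P) z) z :=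
    (((hP.fderiv_right (m := 1) (by norm_num)).differentiable (by norm_num)) z).hasFDerivAt
  have hG : fderiv ℂ (fun y => P y ^ 3) = fun y => (3 * P y ^ 2) • fderiv ℂ P y := by
    funext y
    have := ((h1 y).pow 3).fderiv
    simpa using this
  have h3 := ((((h1 z).pow 2).const_mul 3).smul h2).fderiv
  rw [hG]
  refine ⟨?_, ?_⟩
  · show (3 * P z ^ 2) • fderiv ℂ P z = 0
    rw [h0, zero_pow two_ne_zero, mul_zero]
    exact zero_smul ℂ (fderiv ℂ P z)
  refine Eq.trans h3 ?_
  ext v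
  simp [h0]

theorem exists_P {n m : ℕ} (x : Fin m → En n) (hx : Function.Injective x) (k : Fin m) :
    ∃ P : En n → ℂ, ContDiff ℂ 2 P ∧ P (x k) = 1 ∧ ∀ l, l ≠ k → P (x l) = 0 := by
  refine ⟨fun z => ∏ l ∈ Finset.univ.erase k,
    (innerSL ℂ (x k - x l) (x k - x l))⁻¹ * innerSL ℂ (x k - x l) (z - x l), ?_, ?_, ?_⟩
  · apply contDiff_prod
    intro l _
    exact contDiff_const.mul ((innerSL ℂ (x k - x l)).contDiff.comp (contDiff_id.sub contDiff_const))
  · apply Finset.prod_eq_one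
    intro l hl
    have : x k - x l ≠ 0 := sub_ne_zero.mpr (fun h => (Finset.ne_of_mem_erase hl) (hx h).symm)
    apply inv_mul_cancel₀
    rw [innerSL_apply_apply]
    exact inner_self_ne_zero.mpr this
  · intro l hl
    apply Finset.prod_eq_zero (i := l) (by simp [hl])
    simp

theorem stmt_11 (n m : ℕ) (hn : 2 ≤ n)
    (x : Fin m → En n) (hx : Function.Injective x)
    (A : Fin m → Matrix (Fin n) (Fin n) ℂ) (hA : ∀ j, Matrix.trace (A j) = 0) :
    ∃ v : En n → En n, Differentiable ℂ v ∧
      (∀ z : En n, LinearMap.trace ℂ (En n) ((fderiv ℂ v z : En n →ₗ[ℂ] En n)) = 0) ∧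
      (∀ j, v (x j) = 0) ∧
      (∀ j, (fderiv ℂ v (x j) : En n →ₗ[ℂ] En n) = Matrix.toEuclideanLin (A j)) := by
  choose P hP hP1 hP0 using exists_P x hx
  let L : Fin m → (En n →L[ℂ] En n) := fun k =>
    LinearMap.toContinuousLinearMap (Matrix.toEuclideanLin (A k))
  have hLA : ∀ k, (L k : En n →ₗ[ℂ] En n) = Matrix.toEuclideanLin (A k) := fun k => rfl
  have hL : ∀ k, LinearMap.trace ℂ (En n) (L k : En n →ₗ[ℂ] En n) = 0 := by
    intro k
    rw [hLA, Matrix.toEuclideanLin_eq_toLin_orthonormal, Matrix.trace_toLin_eq]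
    exact hA k
  let φ : Fin m → En n → ℂ := fun k y => P k y ^ 3
  have hφ : ∀ k, ContDiff ℂ 2 (φ k) := fun k => (hP k).pow 3
  have hd : ∀ k, Differentiable ℂ (fieldV (φ k) (L k) (x k)) := fun k z =>
    (fieldV_hasFDerivAt _ (hφ k) _ _ z).differentiableAt
  have hf : ∀ z, fderiv ℂ (fun z => ∑ k, fieldV (φ k) (L k) (x k) z) z
      = ∑ k, fderiv ℂ (fieldV (φ k) (L k) (x k)) z := fun z =>
    fderiv_fun_sum (fun k _ => hd k z)
  refine ⟨fun z => ∑ k, fieldV (φ k) (L k) (x k) z, ?_, ?_, ?_, ?_⟩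
  · exact Differentiable.fun_sum (fun k _ => hd k)
  · intro z
    rw [hf, ContinuousLinearMap.toLinearMap_sum, map_sum]
    exact Finset.sum_eq_zero (fun k _ => fieldV_div (by omega) _ (hφ k) _ (hL k) _ _)
  · intro j
    apply Finset.sum_eq_zero
    intro k _
    by_cases h : j = k
    · subst h; simp [fieldV]
    · have h0 := hP0 k j h
      have := (cube_vanish _ (hP k) _ h0).1
      simp [fieldV, φ, h0, this]
  · intro j
    rw [hf, ← hLA, Finset.sum_eq_single j]
    · rw [(fieldV_hasFDerivAt _ (hφ j) _ _ _).fderiv]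
      ext v
      simp [φ, hP1]
    · intro k _ h
      have h0 := hP0 k j h.symm
      have := cube_vanish _ (hP k) _ h0
      rw [(fieldV_hasFDerivAt _ (hφ k) _ _ _).fderiv]
      ext v
      simp [φ, h0, this.1, this.2]
    · simp
end
end
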